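/- arXiv:1202.0747 — 2 statements merged into one kernel-verified Lean document; each statement's English description precedes it below -/
import Mathlib

section
/- For all positive integers n_1 ≤ n_2 ≤ ... ≤ n_k, M*(n_1, n_2, ..., n_k) ≥ Σ_{i=1}^{k-1} M*(n_i, n_i). -/
/-- A finite directed multigraph. -/
structure MultiDigraph where
  V : Type
  E : Type
  fintV : Fintype V
  fintE : Fintype E
  src : E → V
  dst : E → V

namespace MultiDigraph

/-- `p` is a (nonempty) directed path from `u` to `v`, given as its list of edges. -/
def IsPathFrom (G : MultiDigraph) (u v : G.V) (p : List G.E) : Prop :=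
  p ≠ [] ∧ List.Chain' (fun e f => G.dst e = G.src f) p ∧
    (∀ e ∈ p.head?, G.src e = u) ∧ ∀ e ∈ p.getLast?, G.dst e = v

/-- `G` is acyclic: there is no (nonempty) directed path from a vertex to itself. -/
def Acyclic (G : MultiDigraph) : Prop :=
  ∀ (v : G.V) (p : List G.E), ¬ G.IsPathFrom v v p

/-- `α` is a family of `c` pairwise edge-disjoint directed paths from `u` to `v`. -/
def MengerSystem (G : MultiDigraph) (u v : G.V) (c : ℕ) (α : Fin c → List G.E) : Prop :=
  (∀ i, G.IsPathFrom u v (α i)) ∧ ∀ i j, i ≠ j → ∀ e, e ∈ α i → e ∉ α j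

/-- The min-cut between `u` and `v` equals `c`: by Menger's theorem, this means the
maximum number of pairwise edge-disjoint directed paths from `u` to `v` is exactly `c`. -/
def MinCut (G : MultiDigraph) (u v : G.V) (c : ℕ) : Prop :=
  (∃ α : Fin c → List G.E, G.MengerSystem u v c α) ∧
    ¬∃ α : Fin (c + 1) → List G.E, G.MengerSystem u v (c + 1) α

/-- Edge `e` is the starting edge of a merging among paths from (at least) two different
groups: `e` lies on a path of group `i` and on a path of group `j ≠ i`, and there are two
distinct edges immediately ahead of `e` on these two paths.  Mergings are counted without
multiplicity: one merging per such edge `e`. -/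
def MergingEdge (G : MultiDigraph) {l : ℕ} {c : Fin l → ℕ}
    (α : (i : Fin l) → Fin (c i) → List G.E) (e : G.E) : Prop :=
  ∃ i j : Fin l, i ≠ j ∧ ∃ (a : Fin (c i)) (b : Fin (c j)) (f g : G.E),
    f ≠ g ∧ [f, e] <:+: α i a ∧ [g, e] <:+: α j b

/-- The number of mergings among paths from different groups, `|G|_M(α₁,…,α_l)`. -/
noncomputable def mergingCount (G : MultiDigraph) {l : ℕ} {c : Fin l → ℕ}
    (α : (i : Fin l) → Fin (c i) → List G.E) : ℕ :=
  Set.ncard {e : G.E | G.MergingEdge α e}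

end MultiDigraph

open MultiDigraph

/-- `G` is a finite acyclic directed multigraph with designated sources `S i`, pairwise
distinct sinks `R i`, and min-cut `c i` between `S i` and `R i`. -/
def GoodConfig {l : ℕ} (G : MultiDigraph) (S R : Fin l → G.V) (c : Fin l → ℕ) : Prop :=
  G.Acyclic ∧ Function.Injective R ∧ ∀ i, G.MinCut (S i) (R i) (c i)

/-- `M(c₁,…,c_l) ≤ B`: in every acyclic graph with distinct sources, distinct sinks and
the given min-cuts, some choice of Menger path systems yields at most `B` mergings. -/
def MAtMost {l : ℕ} (c : Fin l → ℕ) (B : ℕ) : Prop :=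
  ∀ (G : MultiDigraph) (S R : Fin l → G.V), GoodConfig G S R c → Function.Injective S →
    ∃ α : (i : Fin l) → Fin (c i) → List G.E,
      (∀ i, G.MengerSystem (S i) (R i) (c i) (α i)) ∧ G.mergingCount α ≤ B

/-- `M(c₁,…,c_l) ≥ B`: some acyclic graph with distinct sources, distinct sinks and the
given min-cuts yields at least `B` mergings for every choice of Menger path systems. -/
def MAtLeast {l : ℕ} (c : Fin l → ℕ) (B : ℕ) : Prop :=
  ∃ (G : MultiDigraph) (S R : Fin l → G.V), GoodConfig G S R c ∧ Function.Injective S ∧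
    ∀ α : (i : Fin l) → Fin (c i) → List G.E,
      (∀ i, G.MengerSystem (S i) (R i) (c i) (α i)) → B ≤ G.mergingCount α

/-- `M(c₁,…,c_l) = B`: the largest possible value, over all acyclic graphs with distinct
sources and distinct sinks realizing the min-cuts `c`, of the minimum number of mergings
over all choices of Menger path systems, equals `B`. -/
def MEq {l : ℕ} (c : Fin l → ℕ) (B : ℕ) : Prop := MAtMost c B ∧ MAtLeast c B

/-- `M*(c₁,…,c_l) ≤ B`: as `MAtMost`, but with all sources identical. -/
def MstarAtMost {l : ℕ} (c : Fin l → ℕ) (B : ℕ) : Prop :=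
  ∀ (G : MultiDigraph) (S R : Fin l → G.V), GoodConfig G S R c → (∀ i j, S i = S j) →
    ∃ α : (i : Fin l) → Fin (c i) → List G.E,
      (∀ i, G.MengerSystem (S i) (R i) (c i) (α i)) ∧ G.mergingCount α ≤ B

/-- `M*(c₁,…,c_l) ≥ B`: as `MAtLeast`, but with all sources identical. -/
def MstarAtLeast {l : ℕ} (c : Fin l → ℕ) (B : ℕ) : Prop :=
  ∃ (G : MultiDigraph) (S R : Fin l → G.V), GoodConfig G S R c ∧ (∀ i j, S i = S j) ∧
    ∀ α : (i : Fin l) → Fin (c i) → List G.E,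
      (∀ i, G.MengerSystem (S i) (R i) (c i) (α i)) → B ≤ G.mergingCount α

/-- `M*(c₁,…,c_l) = B`: as `MEq`, but with all sources identical. -/
def MstarEq {l : ℕ} (c : Fin l → ℕ) (B : ℕ) : Prop := MstarAtMost c B ∧ MstarAtLeast c B

/-- The minimum number of mergings over all choices of the Menger path systems, for a
fixed graph with fixed sources, sinks, and min-cuts. -/
noncomputable def minMergings {l : ℕ} (G : MultiDigraph) (S R : Fin l → G.V)
    (c : Fin l → ℕ) : ℕ :=
  sInf {k : ℕ | ∃ α : (i : Fin l) → Fin (c i) → List G.E,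
    (∀ i, G.MengerSystem (S i) (R i) (c i) (α i)) ∧ G.mergingCount α = k}

/-- `M(c₁,…,c_l)`: the supremum, over all finite acyclic directed multigraphs with `l`
distinct sources, `l` distinct sinks and min-cuts `c`, of the minimum number of mergings
over all choices of the Menger path systems. -/
noncomputable def Mnum {l : ℕ} (c : Fin l → ℕ) : ℕ :=
  sSup {k : ℕ | ∃ (G : MultiDigraph) (S R : Fin l → G.V),
    GoodConfig G S R c ∧ Function.Injective S ∧ minMergings G S R c = k}

/-- `M*(c₁,…,c_l)`: as `Mnum`, but over graphs in which all the sources coincide. -/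
noncomputable def MstarNum {l : ℕ} (c : Fin l → ℕ) : ℕ :=
  sSup {k : ℕ | ∃ (G : MultiDigraph) (S R : Fin l → G.V),
    GoodConfig G S R c ∧ (∀ i j, S i = S j) ∧ minMergings G S R c = k}


namespace MultiDigraph

theorem IsPathFrom.append {G : MultiDigraph} {u v w : G.V} {p q : List G.E}
    (hp : G.IsPathFrom u v p) (hq : G.IsPathFrom v w q) : G.IsPathFrom u w (p ++ q) := by
  obtain ⟨p0, p1, p2, p3⟩ := hp
  obtain ⟨q0, q1, q2, q3⟩ := hq
  refine ⟨by simp [p0], ?_, ?_, ?_⟩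
  · refine List.isChain_append.2 ⟨p1, q1, ?_⟩
    intro x hx y hy
    rw [p3 x hx, q2 y hy]
  · intro e he
    rw [List.head?_append_of_ne_nil _ p0] at he
    exact p2 e he
  · intro e he
    rw [List.getLast?_append_of_ne_nil _ q0] at he
    exact q3 e he

theorem isPathFrom_singleton {G : MultiDigraph} (e : G.E) :
    G.IsPathFrom (G.src e) (G.dst e) [e] := by
  refine ⟨by simp, List.isChain_singleton _, ?_, ?_⟩ <;> simp

theorem path_rank {G : MultiDigraph} {ρ : G.V → ℕ} (h : ∀ e, ρ (G.src e) < ρ (G.dst e)) :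
    ∀ (p : List G.E) (u v : G.V), G.IsPathFrom u v p → ρ u < ρ v := by
  intro p
  induction p with
  | nil => intro u v hp; exact absurd rfl hp.1
  | cons e p ih =>
    intro u v hp
    obtain ⟨-, p1, p2, p3⟩ := hp
    have h1 : G.src e = u := p2 e (by simp)
    subst h1
    rcases p with _ | ⟨f, p⟩
    · have h2 : G.dst e = v := p3 e (by simp)
      subst h2
      exact h e
    · refine (h e).trans (ih (G.dst e) v ⟨by simp, ?_, ?_, ?_⟩)
      · exact (List.isChain_cons_cons.1 p1).2
      · have := (List.isChain_cons_cons.1 p1).1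
        intro x hx
        simp at hx
        subst hx
        exact this.symm
      · intro x hx
        exact p3 x (by simpa [List.getLast?_cons_cons] using hx)

theorem acyclic_of_rank {G : MultiDigraph} {ρ : G.V → ℕ}
    (h : ∀ e, ρ (G.src e) < ρ (G.dst e)) : G.Acyclic := fun v p hp =>
  lt_irrefl _ (path_rank h p v v hp)

theorem exists_rank {G : MultiDigraph} (hG : G.Acyclic) :
    ∃ ρ : G.V → ℕ, ∀ e, ρ (G.src e) < ρ (G.dst e) := by
  classical
  have := G.fintV
  let r : G.V → G.V → Prop := fun u v => ∃ e, G.src e = u ∧ G.dst e = v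
  have hr : ∀ u v, Relation.TransGen r u v → ∃ p, G.IsPathFrom u v p := by
    intro u v h
    induction h with
    | single h =>
      obtain ⟨e, rfl, rfl⟩ := h
      exact ⟨[e], isPathFrom_singleton e⟩
    | tail _ h ih =>
      obtain ⟨e, rfl, rfl⟩ := h
      obtain ⟨p, hp⟩ := ih
      exact ⟨p ++ [e], hp.append (isPathFrom_singleton e)⟩
  refine ⟨fun v => (Finset.univ.filter fun u => Relation.TransGen r u v).card, fun e => ?_⟩
  apply Finset.card_lt_card
  have he : r (G.src e) (G.dst e) := ⟨e, rfl, rfl⟩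
  rw [Finset.ssubset_iff_of_subset]
  · refine ⟨G.src e, by simpa using Relation.TransGen.single he, ?_⟩
    intro h
    simp only [Finset.mem_filter, Finset.mem_univ, true_and] at h
    obtain ⟨p, hp⟩ := hr _ _ h
    exact hG _ _ hp
  · intro u hu
    simp only [Finset.mem_filter, Finset.mem_univ, true_and] at hu ⊢
    exact hu.tail he

/-- adjacency of the bipartite graph for group with sink `t` and value `n` -/
def BAdj (G : MultiDigraph) (C : ℕ) (s t : G.V) (n : ℕ) (A : Set (G.E × G.E)) :
    G.E ⊕ Fin C → G.E ⊕ Fin C → Prop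
  | .inl f, .inl e => f = e ∨ (f, e) ∈ A
  | .inr _, .inl e => G.src e = s
  | .inl f, .inr k => k.val < n ∧ G.dst f = t
  | .inr _, .inr k => n ≤ k.val

/-- critical transitions -/
def Crit (G : MultiDigraph) (C : ℕ) (s t : G.V) (n : ℕ) (A : Set (G.E × G.E))
    (σ : Equiv.Perm (G.E ⊕ Fin C)) (u v : G.E) : Prop :=
  σ (.inl u) = .inl v ∧ ∃ X : Set (G.E ⊕ Fin C), .inl u ∈ X ∧
    (∀ x ∈ X, ∀ y, G.BAdj C s t n A x y → σ.symm y ∈ X) ∧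
    (∀ x ∈ X, G.BAdj C s t n A x (.inl v) → x = .inl u)

theorem crit_of_not {G : MultiDigraph} {C : ℕ} {s t : G.V} {n : ℕ} {A : Set (G.E × G.E)}
    {σ : Equiv.Perm (G.E ⊕ Fin C)} (hσ : ∀ x, G.BAdj C s t n A x (σ x)) {u v : G.E}
    (hno : ¬ ∃ τ : Equiv.Perm (G.E ⊕ Fin C), ∀ x, G.BAdj C s t n (A \ {(u, v)}) x (τ x)) :
    G.Crit C s t n A σ u v := by
  classical
  have := G.fintE
  have hdiff : ∀ x y, G.BAdj C s t n A x y →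
      G.BAdj C s t n (A \ {(u, v)}) x y ∨ (x = .inl u ∧ y = .inl v) := by
    intro x y h
    rcases x with f | k <;> rcases y with e | k' <;> simp only [BAdj] at h ⊢ <;> try tauto
    by_cases hfe : (f, e) = (u, v)
    · right; simp at hfe; simp [hfe]
    · left
      rcases h with h | h
      · exact Or.inl h
      · exact Or.inr ⟨h, hfe⟩
  let T : G.E ⊕ Fin C → Finset (G.E ⊕ Fin C) := fun x =>
    Finset.univ.filter fun y => G.BAdj C s t n (A \ {(u, v)}) x y
  have h1 : ¬ ∀ X : Finset (G.E ⊕ Fin C), X.card ≤ (X.biUnion T).card := by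
    intro hall
    obtain ⟨f, hf, hT⟩ := (Finset.all_card_le_biUnion_card_iff_exists_injective T).1 hall
    refine hno ⟨Equiv.ofBijective f (Finite.injective_iff_bijective.1 hf), fun x => ?_⟩
    simpa [T] using hT x
  push Not at h1
  obtain ⟨X, hX⟩ := h1
  have h2 : (X.image σ).erase (.inl v) ⊆ X.biUnion T := by
    intro y hy
    simp only [Finset.mem_erase, Finset.mem_image] at hy
    obtain ⟨hy, x, hx, rfl⟩ := hy
    rw [Finset.mem_biUnion]
    refine ⟨x, hx, ?_⟩
    rcases hdiff _ _ (hσ x) with h | h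
    · simpa [T] using h
    · exact absurd h.2 hy
  have h3 : (X.image σ).card = X.card := Finset.card_image_of_injective _ σ.injective
  have h4 : Sum.inl v ∈ X.image σ := by
    by_contra h
    rw [Finset.erase_eq_of_notMem h] at h2
    have := Finset.card_le_card h2
    omega
  have h5 : ((X.image σ).erase (.inl v)).card = X.card - 1 := by
    rw [Finset.card_erase_of_mem h4, h3]
  have h6 : (X.image σ).erase (.inl v) = X.biUnion T := by
    apply Finset.eq_of_subset_of_card_le h2
    omega
  have h7 : ∀ x ∈ X, G.BAdj C s t n A x (.inl v) → x = .inl u := by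
    intro x hx h
    rcases hdiff _ _ h with h | h
    · have : Sum.inl v ∈ X.biUnion T := Finset.mem_biUnion.2 ⟨x, hx, by simpa [T] using h⟩
      rw [← h6] at this
      simp at this
    · exact h.1
  obtain ⟨w, hw, hwv⟩ := Finset.mem_image.1 h4
  have hwu : w = .inl u := h7 w hw (hwv ▸ hσ w)
  subst hwu
  refine ⟨hwv, (X : Set _), by exact_mod_cast hw, ?_, by exact_mod_cast h7⟩
  intro x hx y hxy
  have hy : y ∈ X.image σ := by
    rcases hdiff _ _ hxy with h | h
    · have : y ∈ X.biUnion T := Finset.mem_biUnion.2 ⟨x, by exact_mod_cast hx, by simpa [T] using h⟩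
      rw [← h6] at this
      exact Finset.mem_of_mem_erase this
    · rw [h.2]; exact h4
  obtain ⟨z, hz, rfl⟩ := Finset.mem_image.1 hy
  simpa using hz

section pair

variable {G : MultiDigraph} {C : ℕ} {s t t' : G.V} {n n' : ℕ} {A : Set (G.E × G.E)}
  {σ τ : Equiv.Perm (G.E ⊕ Fin C)} {ρ : G.E → ℕ}

/-- successor step -/
def Fw (σ : Equiv.Perm (G.E ⊕ Fin C)) (v w : G.E) : Prop := σ (.inl v) = .inl w

/-- `v` eventually leads to terminal `k` -/
def Reach (σ : Equiv.Perm (G.E ⊕ Fin C)) (v : G.E) (k : Fin C) : Prop :=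
  ∃ w, Relation.ReflTransGen (Fw σ) v w ∧ σ (.inl w) = .inr k

theorem badj_inl {x : G.E ⊕ Fin C} {y : G.E} (h : G.BAdj C s t n A x (.inl y)) :
    G.BAdj C s t' n' A x (.inl y) := by
  rcases x with x | x <;> exact h

theorem fw_rank (hA : ∀ f e, (f, e) ∈ A → ρ f < ρ e)
    (hσ : ∀ x, G.BAdj C s t n A x (σ x)) {v w : G.E}
    (h : Relation.ReflTransGen (Fw σ) v w) : v = w ∨ ρ v < ρ w := by
  induction h with
  | refl => exact Or.inl rfl
  | tail _ h ih =>
    rename_i b c _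
    have h1 := hσ (.inl b)
    rw [h] at h1
    rcases h1 with h1 | h1
    · rwa [← h1]
    · have := hA _ _ h1
      rcases ih with rfl | ih
      · exact Or.inr this
      · exact Or.inr (ih.trans this)

theorem reach_comp {v1 v2 : G.E} {k : Fin C} (h1 : Reach σ v1 k) (h2 : Reach σ v2 k) :
    Relation.ReflTransGen (Fw σ) v1 v2 ∨ Relation.ReflTransGen (Fw σ) v2 v1 := by
  obtain ⟨w, hw, hk⟩ := h1
  obtain ⟨w', hw', hk'⟩ := h2
  have : w = w' := by
    have := σ.injective (hk.trans hk'.symm)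
    simpa using this
  subst this
  have hu : Relator.RightUnique (Function.swap (Fw σ)) := by
    intro a b c hab hac
    have h3 : σ (.inl b) = .inl a := hab
    have h4 : σ (.inl c) = .inl a := hac
    have := σ.injective (h3.trans h4.symm)
    simpa using this
  have := Relation.ReflTransGen.total_of_right_unique hu
    (Relation.reflTransGen_swap.2 hw) (Relation.reflTransGen_swap.2 hw')
  exact this.symm.imp Relation.reflTransGen_swap.1 Relation.reflTransGen_swap.1

theorem reach_unique {v : G.E} {k k' : Fin C} (h1 : Reach σ v k) (h2 : Reach σ v k') : k = k' := by
  obtain ⟨w, hw, hk⟩ := h1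
  obtain ⟨w', hw', hk'⟩ := h2
  have hu : Relator.RightUnique (Fw σ) := by
    intro a b c hab hac
    have h3 : σ (.inl a) = .inl b := hab
    have h4 : σ (.inl a) = .inl c := hac
    simpa using h3.symm.trans h4
  have key : ∀ a b, Relation.ReflTransGen (Fw σ) a b → ∀ k k', σ (.inl a) = .inr k →
      σ (.inl b) = .inr k' → k = k' := by
    intro a b hab k k' ha hb
    rcases Relation.ReflTransGen.cases_head hab with rfl | ⟨c, hc, -⟩
    · simpa using ha.symm.trans hb
    · have hc : σ (.inl a) = .inl c := hc
      simp [ha] at hc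
  rcases Relation.ReflTransGen.total_of_right_unique hu hw hw' with h | h
  · exact key _ _ h _ _ hk hk'
  · exact (key _ _ h _ _ hk' hk).symm

theorem exists_reach (hA : ∀ f e, (f, e) ∈ A → ρ f < ρ e)
    (hσ : ∀ x, G.BAdj C s t n A x (σ x)) {v : G.E} (hv : σ (.inl v) ≠ .inl v) :
    ∃ k, Reach σ v k := by
  have := G.fintE
  obtain ⟨B, hB⟩ : ∃ B, ∀ e, ρ e ≤ B := by
    obtain ⟨B, hB⟩ := (Set.finite_range ρ).bddAbove
    exact ⟨B, fun e => hB ⟨e, rfl⟩⟩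
  induction hm : B - ρ v using Nat.strong_induction_on generalizing v with
  | _ m ih =>
    rcases hx : σ (.inl v) with w | k
    · have h1 := hσ (.inl v)
      rw [hx] at h1 hv
      have hvw : ρ v < ρ w := by
        rcases h1 with h1 | h1
        · exact absurd (by rw [h1]) hv
        · exact hA _ _ h1
      have hw : σ (.inl w) ≠ .inl w := by
        intro h
        have := σ.injective (hx.trans h.symm)
        simp at this
        subst this
        exact lt_irrefl _ hvw
      have := hB w
      obtain ⟨k, z, hz, hk⟩ := ih (B - ρ w) (by omega) hw rfl
      exact ⟨k, z, Relation.ReflTransGen.head hx hz, hk⟩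
    · exact ⟨k, v, .refl, hx⟩

theorem back_mem {X : Set (G.E ⊕ Fin C)}
    (hX : ∀ x ∈ X, ∀ y, G.BAdj C s t n A x y → σ.symm y ∈ X) {v w : G.E}
    (h : Relation.ReflTransGen (Fw σ) v w) (hw : Sum.inl w ∈ X) : Sum.inl v ∈ X := by
  induction h with
  | refl => exact hw
  | tail _ h ih =>
    rename_i b c _
    apply ih
    have := hX _ hw (.inl c) (Or.inl rfl)
    have h : σ (.inl b) = .inl c := h
    rwa [← h, Equiv.symm_apply_apply] at this

theorem pair_key (hA : ∀ f e, (f, e) ∈ A → ρ f < ρ e)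
    (hσ : ∀ x, G.BAdj C s t n A x (σ x)) (hτ : ∀ x, G.BAdj C s t' n' A x (τ x))
    {v1 u1 u1' v2 u2 u2' : G.E}
    (hne1 : u1 ≠ v1) (hne2' : u2' ≠ v2)
    (c1 : G.Crit C s t n A σ u1 v1) (c1' : τ (.inl u1') = .inl v1)
    (c2 : σ (.inl u2) = .inl v2) (c2' : G.Crit C s t' n' A τ u2' v2)
    {k k' : Fin C} (r1 : Reach σ v1 k) (r2 : Reach σ v2 k)
    (r1' : Reach τ v1 k') (r2' : Reach τ v2 k')
    (d : ℕ) (hd : ((σ⁻¹ * τ) ^ d) (.inl u1) = .inl u2)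
    (hd' : ∀ m < d, ∀ b, τ (((σ⁻¹ * τ) ^ m) (.inl u1)) ≠ .inr b) : v1 = v2 := by
  by_contra hv
  obtain ⟨s1, X, uX, X1, X2⟩ := c1
  obtain ⟨s2, Y, uY, Y1, Y2⟩ := c2'
  have hτ' : ∀ m < d, ∃ y, τ (((σ⁻¹ * τ) ^ m) (.inl u1)) = .inl y := by
    intro m hm
    rcases h : τ (((σ⁻¹ * τ) ^ m) (.inl u1)) with y | b
    · exact ⟨y, rfl⟩
    · exact absurd h (hd' m hm b)
  have last : ∀ {σ : Equiv.Perm (G.E ⊕ Fin C)} {a b u : G.E}, a ≠ b → σ (.inl u) = .inl b →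
      Relation.ReflTransGen (Fw σ) a b → Relation.ReflTransGen (Fw σ) a u := by
    intro σ a b u hab hu h
    rcases Relation.ReflTransGen.cases_tail h with h | ⟨c, hc, hcb⟩
    · exact absurd h.symm hab
    · have hcb : σ (.inl c) = .inl b := hcb
      have := σ.injective (hcb.trans hu.symm)
      simp at this
      rwa [this] at hc
  rcases reach_comp r1 r2 with h | h
  · have h1 : ∀ m ≤ d, ((σ⁻¹ * τ) ^ m) (.inl u1) ∈ X := by
      intro m
      induction m with
      | zero => intro _; simpa using uX
      | succ m ih =>
        intro hm
        have h2 := ih (by omega)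
        obtain ⟨y, hy⟩ := hτ' m (by omega)
        have h3 := hτ (((σ⁻¹ * τ) ^ m) (.inl u1))
        rw [hy] at h3
        have h4 := X1 _ h2 _ (badj_inl h3)
        rw [← hy] at h4
        rw [pow_succ', Equiv.Perm.mul_apply, Equiv.Perm.mul_apply]
        exact h4
    have h2 := h1 d le_rfl
    rw [hd] at h2
    have h3 := back_mem X1 (last hv c2 h) h2
    have := X2 _ h3 (Or.inl rfl)
    simp at this
    exact hne1 this.symm
  · rcases reach_comp r1' r2' with h' | h'
    · have h1 := fw_rank hA hσ h
      have h2 := fw_rank hA hτ h'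
      rcases h1 with h1 | h1
      · exact hv h1.symm
      · rcases h2 with h2 | h2
        · exact hv h2
        · omega
    · obtain _ | d := d
      · simp at hd
        subst hd
        rw [s1] at c2
        simp at c2
        exact hv c2
      have h0 : ((σ⁻¹ * τ) ^ d) (.inl u1) = .inl u2' := by
        rw [pow_succ', Equiv.Perm.mul_apply, Equiv.Perm.mul_apply, Equiv.Perm.inv_eq_iff_eq, c2,
          ← s2] at hd
        exact τ.injective hd
      have h1 : ∀ m ≤ d, ((σ⁻¹ * τ) ^ (d - m)) (.inl u1) ∈ Y := by
        intro m
        induction m with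
        | zero => intro _; simpa [h0] using uY
        | succ m ih =>
          intro hm
          have h2 := ih (by omega)
          obtain ⟨y, hy⟩ := hτ' (d - (m + 1)) (by omega)
          have e1 : d - m = (d - (m + 1)) + 1 := by omega
          have e2 : σ (((σ⁻¹ * τ) ^ (d - m)) (.inl u1)) = .inl y := by
            rw [e1, pow_succ', Equiv.Perm.mul_apply, Equiv.Perm.mul_apply, ← hy]
            exact σ.apply_symm_apply _
          have h3 := hσ (((σ⁻¹ * τ) ^ (d - m)) (.inl u1))
          rw [e2] at h3
          have h4 := Y1 _ h2 _ (badj_inl h3)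
          rw [← hy, Equiv.symm_apply_apply] at h4
          exact h4
      have h2 := h1 d le_rfl
      simp at h2
      have h3 := hσ (.inl u1)
      rw [s1] at h3
      have h4 := Y1 _ h2 _ (badj_inl h3)
      rw [← c1', Equiv.symm_apply_apply] at h4
      have h5 := back_mem Y1 (last (Ne.symm hv) c1' h') h4
      have := Y2 _ h5 (Or.inl rfl)
      simp at this
      exact hne2' this.symm

theorem pair_bound (hA : ∀ f e, (f, e) ∈ A → ρ f < ρ e)
    (hσ : ∀ x, G.BAdj C s t n A x (σ x)) (hτ : ∀ x, G.BAdj C s t' n' A x (τ x)) :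
    {v | ∃ u u', u ≠ u' ∧ (u, v) ∈ A ∧ (u', v) ∈ A ∧
      G.Crit C s t n A σ u v ∧ G.Crit C s t' n' A τ u' v}.ncard ≤ C * (C * C) := by
  classical
  have := G.fintE
  set M := {v | ∃ u u', u ≠ u' ∧ (u, v) ∈ A ∧ (u', v) ∈ A ∧
      G.Crit C s t n A σ u v ∧ G.Crit C s t' n' A τ u' v} with hM
  have hex : ∀ v : M, ∃ z : Fin C × Fin C × Fin C, Reach σ v.1 z.1 ∧ Reach τ v.1 z.2.1 ∧
      ∃ m u, σ (.inl u) = .inl v.1 ∧ τ (((σ⁻¹ * τ) ^ m) (.inl u)) = .inr z.2.2 ∧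
        ∀ m' < m, ∀ b, τ (((σ⁻¹ * τ) ^ m') (.inl u)) ≠ .inr b := by
    rintro ⟨v, u, u', huu, hu, hu', c, c'⟩
    have nonid : ∀ {σ : Equiv.Perm (G.E ⊕ Fin C)} {u : G.E}, (u, v) ∈ A → σ (.inl u) = .inl v →
        σ (.inl v) ≠ .inl v := by
      intro σ u hu h1 h2
      have h3 := σ.injective (h1.trans h2.symm)
      simp at h3
      subst h3
      exact lt_irrefl _ (hA _ _ hu)
    obtain ⟨k, hk⟩ := exists_reach hA hσ (nonid hu c.1)
    obtain ⟨k', hk'⟩ := exists_reach hA hτ (nonid hu' c'.1)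
    have hm : ∃ m, ∃ b, τ (((σ⁻¹ * τ) ^ m) (.inl u)) = .inr b := by
      by_contra hcon
      push Not at hcon
      obtain ⟨s1, X, uX, X1, X2⟩ := c
      have h1 : ∀ m, ((σ⁻¹ * τ) ^ m) (.inl u) ∈ X := by
        intro m
        induction m with
        | zero => simpa using uX
        | succ m ih =>
          rcases hy : τ (((σ⁻¹ * τ) ^ m) (.inl u)) with y | b
          · have h3 := hτ (((σ⁻¹ * τ) ^ m) (.inl u))
            rw [hy] at h3
            have h4 := X1 _ ih _ (badj_inl h3)
            rw [← hy] at h4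
            rw [pow_succ', Equiv.Perm.mul_apply, Equiv.Perm.mul_apply]
            exact h4
          · exact absurd hy (hcon m b)
      obtain ⟨N, hN, hN1⟩ := (isOfFinOrder_of_finite (σ⁻¹ * τ)).exists_pow_eq_one
      obtain ⟨N, rfl⟩ : ∃ N', N = N' + 1 := ⟨N - 1, by omega⟩
      have h2 : ((σ⁻¹ * τ) ^ N) (.inl u) = .inl u' := by
        have h3 : ((σ⁻¹ * τ) ^ (N + 1)) (.inl u) = .inl u := by rw [hN1]; rfl
        rw [pow_succ', Equiv.Perm.mul_apply, Equiv.Perm.mul_apply, Equiv.Perm.inv_eq_iff_eq, s1,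
          ← c'.1] at h3
        exact τ.injective h3
      have h3 := h1 N
      rw [h2] at h3
      have := X2 _ h3 (Or.inr hu')
      simp at this
      exact huu this.symm
    obtain ⟨b, hb⟩ := Nat.find_spec hm
    refine ⟨(k, k', b), hk, hk', Nat.find hm, u, c.1, hb, ?_⟩
    intro m' hm' b' hb'
    exact Nat.find_min hm hm' ⟨b', hb'⟩
  choose F hF using hex
  have key : ∀ v w : M, F v = F w → ∀ m1 u1 m2 u2, m2 ≤ m1 → σ (.inl u1) = .inl v.1 →
      σ (.inl u2) = .inl w.1 →
      τ (((σ⁻¹ * τ) ^ m1) (.inl u1)) = .inr (F v).2.2 →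
      τ (((σ⁻¹ * τ) ^ m2) (.inl u2)) = .inr (F w).2.2 →
      (∀ m' < m1, ∀ b, τ (((σ⁻¹ * τ) ^ m') (.inl u1)) ≠ .inr b) → v.1 = w.1 := by
    intro v w hvw m1 u1 m2 u2 hm h1 h2 e1 e2 hmin
    obtain ⟨rv, rv', -⟩ := hF v
    obtain ⟨rw1, rw', -⟩ := hF w
    obtain ⟨a1, a1', -, i1, -, c1, c1'⟩ := v.2
    obtain ⟨a2, a2', -, -, i2, c2, c2'⟩ := w.2
    have q1 : a1 = u1 := by simpa using σ.injective (c1.1.trans h1.symm)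
    have q2 : a2 = u2 := by simpa using σ.injective (c2.1.trans h2.symm)
    subst q1 q2
    rw [← hvw] at rw1 rw' e2
    refine pair_key hA hσ hτ ?_ ?_ c1 c1'.1 c2.1 c2' rv rw1 rv' rw' (m1 - m2) ?_ ?_
    · intro h; rw [h] at i1; exact lt_irrefl _ (hA _ _ i1)
    · intro h; rw [h] at i2; exact lt_irrefl _ (hA _ _ i2)
    · have h3 := τ.injective (e1.trans e2.symm)
      have h4 : m1 = m2 + (m1 - m2) := by omega
      rw [h4, pow_add, Equiv.Perm.mul_apply] at h3
      exact ((σ⁻¹ * τ) ^ m2).injective h3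
    · intro m hm' b
      exact hmin m (by omega) b
  have hinj : Function.Injective F := by
    intro v w hvw
    apply Subtype.ext
    obtain ⟨-, -, m1, u1, h1, e1, q1⟩ := hF v
    obtain ⟨-, -, m2, u2, h2, e2, q2⟩ := hF w
    rcases le_total m2 m1 with h | h
    · exact key v w hvw m1 u1 m2 u2 h h1 h2 e1 e2 q1
    · exact (key w v hvw.symm m2 u2 m1 u1 h h2 h1 e2 e1 q2).symm
  have := Nat.card_le_card_of_injective F hinj
  rw [Nat.card_coe_set_eq] at this
  simpa using this

end pair

end MultiDigraph

namespace MultiDigraph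

theorem infix_idx {α : Type*} {l : List α} {f e : α} (h : [f, e] <:+: l) :
    ∃ m, l[m]? = some f ∧ l[m + 1]? = some e := by
  obtain ⟨s, t, rfl⟩ := h
  refine ⟨s.length, ?_, ?_⟩ <;> simp

theorem infix_mem {α : Type*} {l : List α} {f e : α} (h : [f, e] <:+: l) : f ∈ l ∧ e ∈ l := by
  obtain ⟨s, t, rfl⟩ := h
  simp

theorem nodup_idx {α : Type*} {l : List α} (hl : l.Nodup) {m m' : ℕ} {e : α}
    (h : l[m]? = some e) (h' : l[m']? = some e) : m = m' := by
  obtain ⟨h1, h2⟩ := List.getElem?_eq_some_iff.1 h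
  obtain ⟨h1', h2'⟩ := List.getElem?_eq_some_iff.1 h'
  exact (hl.getElem_inj_iff).1 (h2.trans h2'.symm)

theorem chain_infix {α : Type*} {R : α → α → Prop} {l : List α} {f e : α} (h : l.IsChain R)
    (h' : [f, e] <:+: l) : R f e := by
  have := h.infix h'
  simpa using this

theorem path_nodup {G : MultiDigraph} {ρ : G.V → ℕ} (h : ∀ e, ρ (G.src e) < ρ (G.dst e))
    {l : List G.E} (hl : l.IsChain (fun e f => G.dst e = G.src f)) : l.Nodup := by
  have h1 : l.IsChain (fun e f => ρ (G.src e) < ρ (G.src f)) :=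
    List.IsChain.imp (fun e f (hef : G.dst e = G.src f) => by rw [← hef]; exact h e) hl
  have : IsTrans G.E (fun e f => ρ (G.src e) < ρ (G.src f)) := ⟨fun _ _ _ h h' => h.trans h'⟩
  refine (List.isChain_iff_pairwise.1 h1).imp ?_
  rintro a b hab rfl
  exact lt_irrefl _ hab

/-- the matching relation of a path system -/
inductive MRel {G : MultiDigraph} (C : ℕ) {n : ℕ} (α : Fin n → List G.E) :
    G.E ⊕ Fin C → G.E ⊕ Fin C → Prop
  | start (k : Fin n) (k' : Fin C) (e : G.E) (hk : k.val = k'.val) (h : (α k)[0]? = some e) :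
      MRel C α (.inr k') (.inl e)
  | step (k : Fin n) (f e : G.E) (m : ℕ) (h : (α k)[m]? = some f) (h' : (α k)[m + 1]? = some e) :
      MRel C α (.inl f) (.inl e)
  | hend (k : Fin n) (k' : Fin C) (f : G.E) (hk : k.val = k'.val)
      (h : (α k).getLast? = some f) : MRel C α (.inl f) (.inr k')
  | idle (e : G.E) (h : ∀ k, e ∉ α k) : MRel C α (.inl e) (.inl e)
  | pad (k' : Fin C) (h : n ≤ k'.val) : MRel C α (.inr k') (.inr k')

theorem feasible_of_menger {G : MultiDigraph} {ρ : G.V → ℕ}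
    (h : ∀ e, ρ (G.src e) < ρ (G.dst e)) {C : ℕ} {s t : G.V} {n : ℕ} (hn : n ≤ C)
    {α : Fin n → List G.E} (hα : G.MengerSystem s t n α) :
    ∃ σ : Equiv.Perm (G.E ⊕ Fin C),
      ∀ x, G.BAdj C s t n {p | G.dst p.1 = G.src p.2} x (σ x) := by
  classical
  have := G.fintE
  obtain ⟨hp, hd⟩ := hα
  have same : ∀ {k k' e}, e ∈ α k → e ∈ α k' → k = k' := by
    intro k k' e h1 h2
    by_contra hne
    exact hd k k' hne e h1 h2
  have tot : ∀ x, ∃ y, MRel C α x y := by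
    rintro (e | k)
    · by_cases he : ∃ k, e ∈ α k
      · obtain ⟨k, hk⟩ := he
        obtain ⟨m, hm, hme⟩ := List.getElem_of_mem hk
        by_cases hm' : m + 1 < (α k).length
        · exact ⟨_, .step k e (α k)[m + 1] m (by simp [hm, hme]) (by simp [hm'])⟩
        · refine ⟨_, .hend k ⟨k, k.2.trans_le hn⟩ e rfl ?_⟩
          rw [List.getLast?_eq_getElem?]
          have : (α k).length - 1 = m := by omega
          rw [this]; simp [hm, hme]
      · push Not at he
        exact ⟨_, .idle e he⟩
    · by_cases hk : k.val < n
      · have h0 := (hp ⟨k, hk⟩).1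
        have h1 := List.length_pos_iff.2 h0
        exact ⟨_, .start ⟨k, hk⟩ k ((α ⟨k, hk⟩)[0]) rfl (by simp [h1])⟩
      · exact ⟨_, .pad k (by omega)⟩
  have inj : ∀ x x' y, MRel C α x y → MRel C α x' y → x = x' := by
    intro x x' y h1 h2
    cases h1 with
    | start k k' e hk he =>
      cases h2 with
      | start j j' _ hj he' =>
        have := same (List.mem_of_getElem? he) (List.mem_of_getElem? he')
        subst this
        congr 1; ext; omega
      | step j f _ m hf he' =>
        have := same (List.mem_of_getElem? he) (List.mem_of_getElem? he')
        subst this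
        have := nodup_idx (path_nodup h (hp k).2.1) he he'
        omega
      | idle _ hi => exact absurd (List.mem_of_getElem? he) (hi k)
    | step k f e m hf he =>
      cases h2 with
      | start j j' _ hj he' =>
        have := same (List.mem_of_getElem? he) (List.mem_of_getElem? he')
        subst this
        have := nodup_idx (path_nodup h (hp k).2.1) he he'
        omega
      | step j f' _ m' hf' he' =>
        have := same (List.mem_of_getElem? he) (List.mem_of_getElem? he')
        subst this
        have := nodup_idx (path_nodup h (hp k).2.1) he he'
        have : m = m' := by omega
        subst this
        rw [hf] at hf'
        simpa using hf'
      | idle _ hi => exact absurd (List.mem_of_getElem? he) (hi k)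
    | hend k k' f hk hf =>
      cases h2 with
      | hend j _ f' hj hf' =>
        have : k = j := by ext; omega
        subst this
        rw [hf] at hf'
        simpa using hf'
      | pad _ hj => have := k.2; omega
    | idle e hi =>
      cases h2 with
      | start j j' _ hj he' => exact absurd (List.mem_of_getElem? he') (hi j)
      | step j f' _ m' hf' he' => exact absurd (List.mem_of_getElem? he') (hi j)
      | idle _ hi => rfl
    | pad k hk =>
      cases h2 with
      | hend j _ f' hj hf' => have := j.2; omega
      | pad _ hj => rfl
  choose F hF using tot
  have hinj : Function.Injective F := by
    intro x x' hxx
    exact inj x x' (F x) (hF x) (hxx ▸ hF x')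
  refine ⟨Equiv.ofBijective F (Finite.injective_iff_bijective.1 hinj), fun x => ?_⟩
  have hx := hF x
  simp only [Equiv.ofBijective_apply]
  generalize F x = y at hx
  cases hx with
  | start k k' e hk he =>
    refine (hp k).2.2.1 e ?_
    simpa [List.head?_eq_getElem?] using he
  | step k f e m hf he =>
    right
    obtain ⟨a1, a2⟩ := List.getElem?_eq_some_iff.1 hf
    obtain ⟨b1, b2⟩ := List.getElem?_eq_some_iff.1 he
    have := List.isChain_iff_getElem.1 (hp k).2.1 m b1
    rw [a2, b2] at this
    exact this
  | hend k k' f hk hf =>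
    exact ⟨hk ▸ k.2, (hp k).2.2.2 f hf⟩
  | idle e hi => exact Or.inl rfl
  | pad k hk => exact hk

theorem menger_of_feasible {G : MultiDigraph} {ρ : G.E → ℕ} {C : ℕ} {s t : G.V} {n : ℕ}
    (hn : n ≤ C) {A : Set (G.E × G.E)} (hA0 : ∀ f e, (f, e) ∈ A → G.dst f = G.src e)
    (hA : ∀ f e, (f, e) ∈ A → ρ f < ρ e)
    {σ : Equiv.Perm (G.E ⊕ Fin C)} (hσ : ∀ x, G.BAdj C s t n A x (σ x)) :
    ∃ α : Fin n → List G.E, G.MengerSystem s t n α ∧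
      ∀ k f e, [f, e] <:+: α k → σ (.inl f) = .inl e ∧ (f, e) ∈ A := by
  have tr : ∀ m, ∀ e, ρ e = m → σ (.inl e) ≠ .inl e → ∃ p : List G.E,
      p.IsChain (fun f e => σ (.inl f) = .inl e ∧ (f, e) ∈ A) ∧ p.getLast? = some e ∧
        ∀ f ∈ p.head?, G.src f = s := by
    intro m
    induction m using Nat.strong_induction_on with
    | _ m ih =>
      intro e hm he
      have h1 := hσ (σ.symm (.inl e))
      rw [Equiv.apply_symm_apply] at h1
      rcases hx : σ.symm (.inl e) with f | k
      · rw [hx] at h1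
        have hfe : σ (.inl f) = .inl e := by rw [← hx, Equiv.apply_symm_apply]
        rcases h1 with h1 | h1
        · subst h1; exact absurd hfe he
        · have hlt := hA _ _ h1
          obtain ⟨p, p1, p2, p3⟩ := ih (ρ f) (by omega) f rfl (by
            rw [hfe]; intro h; simp at h; subst h; exact lt_irrefl _ hlt)
          have hpn : p ≠ [] := by rintro rfl; simp at p2
          refine ⟨p ++ [e], ?_, by simp, ?_⟩
          · refine List.isChain_append.2 ⟨p1, List.isChain_singleton _, ?_⟩
            intro x hx y hy
            rw [p2] at hx
            simp at hx hy
            subst hx hy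
            exact ⟨hfe, h1⟩
          · rw [List.head?_append_of_ne_nil _ hpn]
            exact p3
      · rw [hx] at h1
        refine ⟨[e], List.isChain_singleton _, by simp, ?_⟩
        intro f hf
        simp at hf
        subst hf
        exact h1
  have ex : ∀ k : Fin n, ∃ p : List G.E,
      p.IsChain (fun f e => σ (.inl f) = .inl e ∧ (f, e) ∈ A) ∧ G.IsPathFrom s t p ∧
        ∀ f ∈ p.getLast?, σ (.inl f) = .inr ⟨k, k.2.trans_le hn⟩ := by
    intro k
    have h1 := hσ (σ.symm (.inr ⟨k, k.2.trans_le hn⟩))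
    rw [Equiv.apply_symm_apply] at h1
    rcases hx : σ.symm (.inr ⟨k, k.2.trans_le hn⟩) with f | k'
    · rw [hx] at h1
      have hf : σ (.inl f) = .inr ⟨k, k.2.trans_le hn⟩ := by rw [← hx, Equiv.apply_symm_apply]
      obtain ⟨p, p1, p2, p3⟩ := tr _ f rfl (by rw [hf]; simp)
      refine ⟨p, p1, ⟨?_, p1.imp (fun a b h => hA0 _ _ h.2), p3, ?_⟩, ?_⟩
      · rintro rfl; simp at p2
      · intro x hx
        rw [p2] at hx
        simp at hx
        subst hx
        exact h1.2
      · intro x hx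
        rw [p2] at hx
        simp at hx
        subst hx
        exact hf
    · rw [hx] at h1
      have h1 : n ≤ k.val := h1
      have := k.2
      omega
  choose α h1 h2 h3 using ex
  have hr : ∀ k, ∀ e ∈ α k, Reach σ e ⟨k, k.2.trans_le hn⟩ := by
    intro k
    have key : ∀ p : List G.E, p.IsChain (fun f e => σ (.inl f) = .inl e ∧ (f, e) ∈ A) →
        (∀ f ∈ p.getLast?, σ (.inl f) = .inr ⟨k, k.2.trans_le hn⟩) → ∀ e ∈ p,
        Reach σ e ⟨k, k.2.trans_le hn⟩ := by
      intro p
      induction p with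
      | nil => simp
      | cons a p ih =>
        intro c1 c2 e he
        rcases p with _ | ⟨b, p⟩
        · simp at he
          subst he
          exact ⟨e, .refl, c2 e (by simp)⟩
        · have ih' := ih (List.isChain_cons_cons.1 c1).2 (by
            intro x hx
            exact c2 x (by simpa [List.getLast?_cons_cons] using hx))
          rcases List.mem_cons.1 he with rfl | he
          · obtain ⟨w, hw, hk⟩ := ih' b (by simp)
            exact ⟨w, .head (List.isChain_cons_cons.1 c1).1.1 hw, hk⟩
          · exact ih' e he
    exact key (α k) (h1 k) (h3 k)
  refine ⟨α, ⟨h2, ?_⟩, ?_⟩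
  · intro i j hij e hi hj
    have := reach_unique (hr i e hi) (hr j e hj)
    simp at this
    exact hij (Fin.ext this)
  · intro k f e hfe
    exact chain_infix (R := fun f e => σ (.inl f) = .inl e ∧ (f, e) ∈ A) (h1 k) hfe

theorem merging_bound {l : ℕ} (c : Fin l → ℕ) (G : MultiDigraph) (S R : Fin l → G.V)
    (hG : GoodConfig G S R c) (hS : ∀ i j, S i = S j) :
    ∃ α : (i : Fin l) → Fin (c i) → List G.E,
      (∀ i, G.MengerSystem (S i) (R i) (c i) (α i)) ∧
        G.mergingCount α ≤ (l * l) * ((∑ i, c i) * ((∑ i, c i) * (∑ i, c i))) := by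
  classical
  have := G.fintE
  obtain ⟨hac, -, hcut⟩ := hG
  obtain ⟨ρ, hρ⟩ := exists_rank hac
  set C := ∑ i, c i with hC
  have hcC : ∀ i, c i ≤ C := fun i => Finset.single_le_sum (f := c) (by simp) (Finset.mem_univ i)
  let P : Set (G.E × G.E) → Prop := fun A => A ⊆ {p | G.dst p.1 = G.src p.2} ∧
    ∀ i, ∃ σ : Equiv.Perm (G.E ⊕ Fin C), ∀ x, G.BAdj C (S i) (R i) (c i) A x (σ x)
  have hP : ∃ A, P A := by
    refine ⟨{p | G.dst p.1 = G.src p.2}, subset_rfl, fun i => ?_⟩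
    obtain ⟨α, hα⟩ := (hcut i).1
    exact feasible_of_menger hρ (hcC i) hα
  obtain ⟨A, hAP, hmin⟩ : ∃ A, P A ∧ ∀ B, P B → B ⊆ A → B = A := by
    obtain ⟨A, hA⟩ := (Set.toFinite {A | P A}).exists_minimal hP
    exact ⟨A, hA.1, fun B hB hBA => le_antisymm hBA (hA.2 hB hBA)⟩
  obtain ⟨hA0, hfe⟩ := hAP
  choose σ hσ using hfe
  have hA0' : ∀ f e, (f, e) ∈ A → G.dst f = G.src e := fun f e h => hA0 h
  have hAρ : ∀ f e, (f, e) ∈ A → ρ (G.src f) < ρ (G.src e) := by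
    intro f e h
    rw [← hA0' f e h]
    exact hρ f
  have hcrit : ∀ u v, (u, v) ∈ A → ∃ i, G.Crit C (S i) (R i) (c i) A (σ i) u v := by
    intro u v huv
    by_contra hcon
    push Not at hcon
    have h1 : P (A \ {(u, v)}) := by
      refine ⟨Set.sdiff_subset.trans hA0, fun i => ?_⟩
      by_contra hno
      exact hcon i (crit_of_not (hσ i) hno)
    have h2 := hmin _ h1 Set.sdiff_subset
    rw [← h2] at huv
    exact huv.2 rfl
  have hm := fun i => menger_of_feasible (ρ := fun e => ρ (G.src e)) (hcC i) hA0' hAρ (hσ i)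
  choose α hα hαA using hm
  refine ⟨α, hα, ?_⟩
  let M : Fin l × Fin l → Set G.E := fun ij => {v | ∃ u u', u ≠ u' ∧ (u, v) ∈ A ∧ (u', v) ∈ A ∧
      G.Crit C (S ij.1) (R ij.1) (c ij.1) A (σ ij.1) u v ∧
      G.Crit C (S ij.2) (R ij.2) (c ij.2) A (σ ij.2) u' v}
  have hM : ∀ ij, (M ij).ncard ≤ C * (C * C) := by
    intro ij
    have h1 := hσ ij.2
    have h2 : S ij.2 = S ij.1 := hS _ _
    simp only [M]
    rw [h2] at h1 ⊢
    exact pair_bound (ρ := fun e => ρ (G.src e)) hAρ (hσ ij.1) h1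
  have hsub : {e | G.MergingEdge α e} ⊆ ⋃ ij ∈ (Finset.univ : Finset (Fin l × Fin l)), M ij := by
    rintro e ⟨i, j, -, a, b, f, g, hfg, hf, hg⟩
    have h1 := (hαA i a f e hf).2
    have h2 := (hαA j b g e hg).2
    obtain ⟨i', hi'⟩ := hcrit _ _ h1
    obtain ⟨j', hj'⟩ := hcrit _ _ h2
    simp only [Finset.mem_univ, Set.iUnion_true, Set.mem_iUnion]
    exact ⟨(i', j'), f, g, hfg, h1, h2, hi', hj'⟩
  calc G.mergingCount α ≤ (⋃ ij ∈ (Finset.univ : Finset (Fin l × Fin l)), M ij).ncard :=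
        Set.ncard_le_ncard hsub (Set.toFinite _)
    _ ≤ ∑ ij ∈ (Finset.univ : Finset (Fin l × Fin l)), (M ij).ncard :=
        Finset.set_ncard_biUnion_le _ _
    _ ≤ ∑ ij ∈ (Finset.univ : Finset (Fin l × Fin l)), C * (C * C) :=
        Finset.sum_le_sum fun ij _ => hM ij
    _ = (l * l) * (C * (C * C)) := by simp

end MultiDigraph

theorem mstar_bdd {l : ℕ} (c : Fin l → ℕ) : BddAbove {k : ℕ | ∃ (G : MultiDigraph) (S R : Fin l → G.V),
    GoodConfig G S R c ∧ (∀ i j, S i = S j) ∧ minMergings G S R c = k} := by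
  refine ⟨(l * l) * ((∑ i, c i) * ((∑ i, c i) * (∑ i, c i))), ?_⟩
  rintro k ⟨G, S, R, hG, hS, rfl⟩
  obtain ⟨α, hα, hb⟩ := merging_bound c G S R hG hS
  refine le_trans ?_ hb
  exact Nat.sInf_le ⟨α, hα, rfl⟩

theorem le_mstar {l : ℕ} {c : Fin l → ℕ} {B : ℕ} (h : MstarAtLeast c B) : B ≤ MstarNum c := by
  obtain ⟨G, S, R, hG, hS, hB⟩ := h
  have h1 : B ≤ minMergings G S R c := by
    apply le_csInf
    · obtain ⟨α, hα, -⟩ := merging_bound c G S R hG hS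
      exact ⟨_, α, hα, rfl⟩
    · rintro k ⟨α, hα, rfl⟩
      exact hB α hα
  exact h1.trans (le_csSup (mstar_bdd c) ⟨G, S, R, hG, hS, rfl⟩)

theorem mstarAtLeast_of_zero {l : ℕ} {c : Fin l → ℕ} (h : MstarAtLeast c 0) :
    MstarAtLeast c (MstarNum c) := by
  obtain ⟨G, S, R, hG, hS, -⟩ := h
  have h1 := Nat.sSup_mem (s := {k : ℕ | ∃ (G : MultiDigraph) (S R : Fin l → G.V),
    GoodConfig G S R c ∧ (∀ i j, S i = S j) ∧ minMergings G S R c = k})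
    ⟨_, G, S, R, hG, hS, rfl⟩ (mstar_bdd c)
  obtain ⟨G, S, R, hG, hS, h2⟩ := h1
  refine ⟨G, S, R, hG, hS, fun α hα => ?_⟩
  unfold MstarNum
  rw [← h2]
  exact Nat.sInf_le ⟨α, hα, rfl⟩

namespace MultiDigraph

/-- walks -/
def W (G : MultiDigraph) : G.V → G.V → List G.E → Prop
  | u, v, [] => u = v
  | u, v, e :: p => G.src e = u ∧ W G (G.dst e) v p

theorem isPathFrom_iff {G : MultiDigraph} {p : List G.E} : ∀ {u v : G.V},
    G.IsPathFrom u v p ↔ p ≠ [] ∧ G.W u v p := by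
  induction p with
  | nil => intro u v; simp [IsPathFrom]
  | cons e p ih =>
    intro u v
    rcases p with _ | ⟨f, p⟩
    · unfold IsPathFrom
      simp only [W]
      constructor
      · rintro ⟨-, -, h1, h2⟩
        exact ⟨by simp, h1 e (by simp), h2 e (by simp)⟩
      · rintro ⟨-, h1, h2⟩
        exact ⟨by simp, List.isChain_singleton _, by simpa using h1, by simpa using h2⟩
    · have := @ih (G.dst e) v
      constructor
      · rintro ⟨h0, h1, h2, h3⟩
        refine ⟨h0, h2 e (by simp), (this.1 ⟨by simp, (List.isChain_cons_cons.1 h1).2, ?_, ?_⟩).2⟩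
        · have := (List.isChain_cons_cons.1 h1).1
          simpa using this.symm
        · intro x hx
          exact h3 x (by simpa [List.getLast?_cons_cons] using hx)
      · rintro ⟨h0, h1, h2⟩
        obtain ⟨g0, g1, g2, g3⟩ := this.2 ⟨by simp, h2⟩
        refine ⟨h0, List.isChain_cons_cons.2 ⟨(g2 f (by simp)).symm, g1⟩, by simpa using h1, ?_⟩
        intro x hx
        exact g3 x (by simpa [List.getLast?_cons_cons] using hx)

theorem W.append {G : MultiDigraph} {p q : List G.E} : ∀ {u v w : G.V}, G.W u v p → G.W v w q →
    G.W u w (p ++ q) := by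
  induction p with
  | nil => intro u v w h1 h2; simp only [W] at h1; subst h1; simpa using h2
  | cons e p ih => intro u v w h1 h2; exact ⟨h1.1, ih h1.2 h2⟩

theorem W.path {G : MultiDigraph} {p : List G.E} {u v : G.V} (h : G.W u v p) (huv : u ≠ v) :
    G.IsPathFrom u v p := by
  refine isPathFrom_iff.2 ⟨?_, h⟩
  rintro rfl
  exact huv h

theorem W.nil_of_acyclic {G : MultiDigraph} (hG : G.Acyclic) {p : List G.E} {u : G.V}
    (h : G.W u u p) : p = [] := by
  by_contra hp
  exact hG u p (isPathFrom_iff.2 ⟨hp, h⟩)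

/-- the star graph -/
abbrev star {l : ℕ} (c : Fin l → ℕ) : MultiDigraph where
  V := Option (Fin l)
  E := Σ i, Fin (c i)
  fintV := inferInstance
  fintE := inferInstance
  src := fun _ => none
  dst := fun e => some e.1

theorem star_path {l : ℕ} (c : Fin l → ℕ) {i : Fin l} {p : List (star c).E}
    (h : (star c).IsPathFrom none (some i) p) : ∃ x : Fin (c i), p = [⟨i, x⟩] := by
  obtain ⟨h0, h1⟩ := isPathFrom_iff.1 h
  rcases p with _ | ⟨⟨j, x⟩, _ | ⟨f, p⟩⟩
  · exact absurd rfl h0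
  · have h2 : (some j : Option (Fin l)) = some i := h1.2
    simp at h2
    subst h2
    exact ⟨x, rfl⟩
  · have h2 : (none : Option (Fin l)) = some j := h1.2.1
    simp at h2

theorem star_atLeast {l : ℕ} (c : Fin l → ℕ) : MstarAtLeast c 0 := by
  refine ⟨star c, fun _ => none, fun i => some i, ⟨?_, ?_, ?_⟩, fun _ _ => rfl, fun _ _ => by simp⟩
  · refine acyclic_of_rank (ρ := fun v : Option (Fin l) => if v = none then 0 else 1) ?_
    intro e
    simp
  · intro i j h
    exact Option.some.inj h
  · intro i
    refine ⟨⟨fun x => [⟨i, x⟩], fun x => isPathFrom_singleton (G := star c) ⟨i, x⟩, ?_⟩, ?_⟩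
    · intro x y hxy e h1 h2
      rw [List.mem_singleton] at h1 h2
      rw [h1] at h2
      simp at h2
      exact hxy h2
    · rintro ⟨α, hα, hd⟩
      choose x hx using fun a => star_path c (hα a)
      have hinj : Function.Injective x := by
        intro a b hab
        by_contra hne
        refine hd a b hne ⟨i, x a⟩ ?_ ?_
        · rw [hx]; simp
        · rw [hx, hab]; simp
      have := Fintype.card_le_of_injective x hinj
      simp at this

/-- vertices of the joined graph -/
inductive JV (H G : MultiDigraph) : Type
  | h (v : H.V) | g (v : G.V) | z

/-- edges of the joined graph -/
inductive JE (H G : MultiDigraph) (n d : ℕ) : Type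
  | h (e : H.E) | g (e : G.E) | a (x : Fin n) | b (x : Fin n) | d (x : Fin d)

/-- the joined graph -/
noncomputable abbrev J (H G : MultiDigraph) (S r : H.V) (s r2 : G.V) (n d : ℕ) : MultiDigraph where
  V := JV H G
  E := JE H G n d
  fintV := by
    have := H.fintV
    have := G.fintV
    exact Fintype.ofInjective (β := H.V ⊕ G.V ⊕ Unit) (fun v => match v with
      | .h v => .inl v
      | .g v => .inr (.inl v)
      | .z => .inr (.inr ())) (by
        intro x y hxy
        cases x <;> cases y <;> simp_all)
  fintE := by
    have := H.fintE
    have := G.fintE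
    exact Fintype.ofInjective (β := H.E ⊕ G.E ⊕ Fin n ⊕ Fin n ⊕ Fin d) (fun v => match v with
      | .h v => .inl v
      | .g v => .inr (.inl v)
      | .a v => .inr (.inr (.inl v))
      | .b v => .inr (.inr (.inr (.inl v)))
      | .d v => .inr (.inr (.inr (.inr v)))) (by
        intro x y hxy
        cases x <;> cases y <;> simp_all)
  src := fun e => match e with
    | .h e => .h (H.src e)
    | .g e => .g (G.src e)
    | .a _ => .h r
    | .b _ => .g r2
    | .d _ => .h S
  dst := fun e => match e with
    | .h e => .h (H.dst e)
    | .g e => .g (G.dst e)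
    | .a _ => .g s
    | .b _ => .z
    | .d _ => .z

section join

variable {H G : MultiDigraph} {S r : H.V} {s r2 : G.V} {n d : ℕ}

theorem J_acyclic (hH : H.Acyclic) (hG : G.Acyclic) : (J H G S r s r2 n d).Acyclic := by
  obtain ⟨ρ, hρ⟩ := exists_rank hH
  obtain ⟨μ, hμ⟩ := exists_rank hG
  have := H.fintV
  have := G.fintV
  obtain ⟨B, hB⟩ : ∃ B, ∀ e, ρ e ≤ B := by
    obtain ⟨B, hB⟩ := (Set.finite_range ρ).bddAbove
    exact ⟨B, fun e => hB ⟨e, rfl⟩⟩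
  obtain ⟨B', hB'⟩ : ∃ B, ∀ e, μ e ≤ B := by
    obtain ⟨B, hB⟩ := (Set.finite_range μ).bddAbove
    exact ⟨B, fun e => hB ⟨e, rfl⟩⟩
  refine acyclic_of_rank (ρ := fun v : JV H G => match v with
    | .h v => ρ v
    | .g v => B + 1 + μ v
    | .z => B + 1 + B' + 1) ?_
  intro e
  rcases e with e | e | x | x | x
  · exact hρ e
  · have := hμ e
    simp only; omega
  · have := hB r
    simp only; omega
  · have := hB' r2
    simp only; omega
  · have := hB S
    simp only; omega

theorem J_W_h {p : List H.E} : ∀ {u v : H.V}, H.W u v p →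
    (J H G S r s r2 n d).W (.h u) (.h v) (p.map JE.h) := by
  induction p with
  | nil => intro u v h; exact congrArg _ h
  | cons e p ih => intro u v h; exact ⟨congrArg JV.h h.1, ih h.2⟩

theorem J_W_g {p : List G.E} : ∀ {u v : G.V}, G.W u v p →
    (J H G S r s r2 n d).W (.g u) (.g v) (p.map JE.g) := by
  induction p with
  | nil => intro u v h; exact congrArg _ h
  | cons e p ih => intro u v h; exact ⟨congrArg JV.g h.1, ih h.2⟩

theorem J_from_z {p : List (JE H G n d)} {v : JV H G} (h : (J H G S r s r2 n d).W .z v p) :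
    p = [] ∧ v = .z := by
  rcases p with _ | ⟨e, p⟩
  · exact ⟨rfl, Eq.symm h⟩
  · have h1 := h.1
    rcases e with e | e | x | x | x <;> cases h1

theorem J_from_g {p : List (JE H G n d)} : ∀ {u : G.V} {v : JV H G},
    (J H G S r s r2 n d).W (.g u) v p →
    (∃ q w, v = .g w ∧ p = q.map JE.g ∧ G.W u w q) ∨
    (v = .z ∧ ∃ q y, p = q.map JE.g ++ [JE.b y] ∧ G.W u r2 q) := by
  induction p with
  | nil => intro u v h; exact Or.inl ⟨[], u, Eq.symm h, rfl, rfl⟩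
  | cons e p ih =>
    rintro u v ⟨h1, h2⟩
    rcases e with e | e | x | x | x
    · cases h1
    · cases h1
      rcases ih h2 with ⟨q, w, rfl, rfl, h3⟩ | ⟨rfl, q, y, rfl, h3⟩
      · exact Or.inl ⟨e :: q, w, rfl, rfl, rfl, h3⟩
      · exact Or.inr ⟨rfl, e :: q, y, rfl, rfl, h3⟩
    · cases h1
    · cases h1
      obtain ⟨rfl, rfl⟩ := J_from_z h2
      exact Or.inr ⟨rfl, [], x, rfl, rfl⟩
    · cases h1

theorem J_from_h {p : List (JE H G n d)} : ∀ {u : H.V} {v : JV H G},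
    (J H G S r s r2 n d).W (.h u) v p →
    (∃ q w, v = .h w ∧ p = q.map JE.h ∧ H.W u w q) ∨
    (∃ q x p', p = q.map JE.h ++ JE.a x :: p' ∧ H.W u r q ∧
      (J H G S r s r2 n d).W (.g s) v p') ∨
    (v = .z ∧ ∃ q y, p = q.map JE.h ++ [JE.d y] ∧ H.W u S q) := by
  induction p with
  | nil => intro u v h; exact Or.inl ⟨[], u, Eq.symm h, rfl, rfl⟩
  | cons e p ih =>
    rintro u v ⟨h1, h2⟩
    rcases e with e | e | x | x | x
    · cases h1
      rcases ih h2 with ⟨q, w, rfl, rfl, h3⟩ | ⟨q, x, p', rfl, h3, h4⟩ | ⟨rfl, q, y, rfl, h3⟩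
      · exact Or.inl ⟨e :: q, w, rfl, rfl, rfl, h3⟩
      · exact Or.inr (Or.inl ⟨e :: q, x, p', rfl, ⟨rfl, h3⟩, h4⟩)
      · exact Or.inr (Or.inr ⟨rfl, e :: q, y, rfl, rfl, h3⟩)
    · cases h1
    · cases h1
      exact Or.inr (Or.inl ⟨[], x, p, rfl, rfl, h2⟩)
    · cases h1
    · cases h1
      obtain ⟨rfl, rfl⟩ := J_from_z h2
      exact Or.inr (Or.inr ⟨rfl, [], x, rfl, rfl⟩)

theorem J_D1 {w : H.V} {m : ℕ} {α : Fin m → List (JE H G n d)}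
    (hα : (J H G S r s r2 n d).MengerSystem (.h S) (.h w) m α) :
    ∃ β : Fin m → List H.E, H.MengerSystem S w m β ∧ ∀ i, α i = (β i).map JE.h := by
  have h1 : ∀ i, ∃ q : List H.E, α i = q.map JE.h ∧ H.IsPathFrom S w q := by
    intro i
    obtain ⟨h0, h1⟩ := isPathFrom_iff.1 (hα.1 i)
    rcases J_from_h h1 with ⟨q, w, hw, hq, h3⟩ | ⟨q, x, p', hq, h3, h4⟩ | ⟨hq, -⟩
    · cases hw
      refine ⟨q, hq, isPathFrom_iff.2 ⟨?_, h3⟩⟩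
      rintro rfl
      exact h0 hq
    · rcases J_from_g h4 with ⟨_, _, h5, -⟩ | ⟨h5, -⟩ <;> cases h5
    · cases hq
  choose β h1 h2 using h1
  refine ⟨β, ⟨h2, ?_⟩, h1⟩
  intro i j hij e hi hj
  refine hα.2 i j hij (JE.h e) ?_ ?_ <;> rw [h1] <;> exact List.mem_map_of_mem (by assumption)

theorem J_D2 (hSr : S ≠ r) {w : G.V} (hsw : s ≠ w) {m : ℕ} {α : Fin m → List (JE H G n d)}
    (hα : (J H G S r s r2 n d).MengerSystem (.h S) (.g w) m α) :
    m ≤ n ∧ ∃ (β : Fin m → List H.E) (γ : Fin m → List G.E), H.MengerSystem S r m β ∧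
      G.MengerSystem s w m γ ∧ (∀ i, (β i).map JE.h <:+: α i) ∧
      (∀ i, (γ i).map JE.g <:+: α i) := by
  have h1 : ∀ i, ∃ (q : List H.E) (x : Fin n) (p : List G.E),
      α i = q.map JE.h ++ JE.a x :: p.map JE.g ∧ H.IsPathFrom S r q ∧ G.IsPathFrom s w p := by
    intro i
    obtain ⟨h0, h1⟩ := isPathFrom_iff.1 (hα.1 i)
    rcases J_from_h h1 with ⟨q, w, hw, hq, h3⟩ | ⟨q, x, p', hq, h3, h4⟩ | ⟨hq, -⟩
    · cases hw
    · rcases J_from_g h4 with ⟨p, _, h5, rfl, h6⟩ | ⟨h5, -⟩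
      · cases h5
        exact ⟨q, x, p, hq, h3.path hSr, h6.path hsw⟩
      · cases h5
    · cases hq
  choose β x γ h1 h2 h3 using h1
  refine ⟨?_, β, γ, ⟨h2, ?_⟩, ⟨h3, ?_⟩, ?_, ?_⟩
  · have hinj : Function.Injective x := by
      intro i j hij
      by_contra hne
      refine hα.2 i j hne (JE.a (x i)) ?_ ?_
      · rw [h1]; simp
      · rw [h1, hij]; simp
    simpa using Fintype.card_le_of_injective x hinj
  · intro i j hij e hi hj
    refine hα.2 i j hij (JE.h e) ?_ ?_ <;> rw [h1] <;> simpa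
  · intro i j hij e hi hj
    refine hα.2 i j hij (JE.g e) ?_ ?_ <;> rw [h1] <;> simpa
  · intro i
    rw [h1]
    exact (List.prefix_append _ _).isInfix
  · intro i
    rw [h1]
    exact ⟨(β i).map JE.h ++ [JE.a (x i)], [], by simp⟩

theorem J_D3 (hsr : s ≠ r2) {m : ℕ} {α : Fin m → List (JE H G n d)}
    (hα : (J H G S r s r2 n d).MengerSystem (.h S) .z m α) :
    m ≤ n + d ∧ (m = n + d → ∃ (γ : Fin n → List G.E),
      G.MengerSystem s r2 n γ ∧ ∀ y, ∃ i, (γ y).map JE.g <:+: α i) := by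
  have h1 : ∀ i, ∃ L : Fin n ⊕ Fin d,
      (∀ y, L = .inr y → JE.d y ∈ α i) ∧
      (∀ y, L = .inl y → JE.b y ∈ α i ∧ ∃ p : List G.E, p.map JE.g <:+: α i ∧
        G.IsPathFrom s r2 p) := by
    intro i
    obtain ⟨h0, h1⟩ := isPathFrom_iff.1 (hα.1 i)
    rcases J_from_h h1 with ⟨q, w, hw, hq, h3⟩ | ⟨q, x, p', hq, h3, h4⟩ | ⟨-, q, y, hq, h3⟩
    · cases hw
    · rcases J_from_g h4 with ⟨p, _, h5, rfl, h6⟩ | ⟨-, p, y, rfl, h5⟩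
      · cases h5
      · refine ⟨.inl y, by simp, ?_⟩
        intro y' hy
        cases hy
        refine ⟨by rw [hq]; simp, p, ?_, h5.path hsr⟩
        rw [hq]
        exact ⟨q.map JE.h ++ [JE.a x], [JE.b y], by simp⟩
    · refine ⟨.inr y, ?_, by simp⟩
      intro y' hy
      cases hy
      rw [hq]; simp
  choose L h1 h2 using h1
  have hinj : Function.Injective L := by
    intro i j hij
    by_contra hne
    rcases hL : L i with y | y
    · exact hα.2 i j hne _ (h2 i y hL).1 (h2 j y (hij ▸ hL)).1
    · exact hα.2 i j hne _ (h1 i y hL) (h1 j y (hij ▸ hL))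
  refine ⟨by simpa using Fintype.card_le_of_injective L hinj, fun hm => ?_⟩
  have hbij : Function.Bijective L :=
    (Fintype.bijective_iff_injective_and_card L).2 ⟨hinj, by simpa using hm⟩
  choose ix hix using fun y : Fin n => hbij.2 (.inl y)
  choose γ hγ using fun y => (h2 (ix y) y (hix y)).2
  refine ⟨γ, ⟨fun y => (hγ y).2, ?_⟩, fun y => ⟨ix y, (hγ y).1⟩⟩
  intro y y' hy e he he'
  have hne : ix y ≠ ix y' := by
    intro h
    have := hix y
    rw [h, hix y'] at this
    simp at this
    exact hy this.symm
  exact hα.2 _ _ hne (JE.g e) ((hγ y).1.subset (List.mem_map_of_mem he))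
    ((hγ y').1.subset (List.mem_map_of_mem he'))

theorem J_E1 {w : H.V} {m : ℕ} {β : Fin m → List H.E} (hβ : H.MengerSystem S w m β) :
    (J H G S r s r2 n d).MengerSystem (.h S) (.h w) m (fun i => (β i).map JE.h) := by
  refine ⟨fun i => ?_, ?_⟩
  · obtain ⟨h0, h1⟩ := isPathFrom_iff.1 (hβ.1 i)
    exact isPathFrom_iff.2 ⟨by simpa using h0, J_W_h h1⟩
  · intro i j hij e hi hj
    obtain ⟨f, hf, rfl⟩ := List.mem_map.1 hi
    obtain ⟨f', hf', h⟩ := List.mem_map.1 hj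
    cases h
    exact hβ.2 i j hij _ hf hf'

theorem J_E2 {w : G.V} {β : Fin n → List H.E} (hβ : H.MengerSystem S r n β)
    {γ : Fin n → List G.E} (hγ : G.MengerSystem s w n γ) :
    (J H G S r s r2 n d).MengerSystem (.h S) (.g w) n
      (fun i => (β i).map JE.h ++ JE.a i :: (γ i).map JE.g) := by
  refine ⟨fun i => ?_, ?_⟩
  · obtain ⟨h0, h1⟩ := isPathFrom_iff.1 (hβ.1 i)
    obtain ⟨g0, g1⟩ := isPathFrom_iff.1 (hγ.1 i)
    refine isPathFrom_iff.2 ⟨by simp, (J_W_h h1).append ⟨rfl, J_W_g g1⟩⟩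
  · intro i j hij e hi hj
    have h1 := hβ.2 i j hij
    have h2 := hγ.2 i j hij
    change JE H G n d at e
    rcases e with e | e | x | x | x <;> simp at hi hj
    · exact h1 e hi hj
    · exact h2 e hi hj
    · exact hij (hi.symm.trans hj)

theorem J_E3 {β : Fin n → List H.E} (hβ : H.MengerSystem S r n β)
    {γ : Fin n → List G.E} (hγ : G.MengerSystem s r2 n γ) :
    ∃ α, (J H G S r s r2 n d).MengerSystem (.h S) .z (n + d) α := by
  refine ⟨fun i => Fin.addCases (motive := fun _ => List (JE H G n d))
      (fun i => (β i).map JE.h ++ JE.a i :: ((γ i).map JE.g ++ [JE.b i]))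
      (fun y => [JE.d y]) i, ?_, ?_⟩
  · intro i
    refine Fin.addCases (fun i => ?_) (fun i => ?_) i
    · beta_reduce; rw [Fin.addCases_left]
      obtain ⟨h0, h1⟩ := isPathFrom_iff.1 (hβ.1 i)
      obtain ⟨g0, g1⟩ := isPathFrom_iff.1 (hγ.1 i)
      refine isPathFrom_iff.2 ⟨by simp, (J_W_h h1).append ⟨rfl, (J_W_g g1).append ⟨rfl, rfl⟩⟩⟩
    · beta_reduce; rw [Fin.addCases_right]
      exact isPathFrom_iff.2 ⟨by simp, rfl, rfl⟩
  · intro i j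
    refine Fin.addCases (fun i => ?_) (fun i => ?_) i <;>
      refine Fin.addCases (fun j => ?_) (fun j => ?_) j <;> intro hij e hi hj <;>
      simp only [Fin.addCases_left, Fin.addCases_right] at hi hj <;>
      change JE H G n d at e
    · have hij' : i ≠ j := fun h => hij (by rw [h])
      have h1 := hβ.2 i j hij'
      have h2 := hγ.2 i j hij'
      rcases e with e | e | x | x | x <;> simp at hi hj
      · exact h1 e hi hj
      · exact h2 e hi hj
      · exact hij' (hi.symm.trans hj)
      · exact hij' (hi.symm.trans hj)
    · rcases e with e | e | x | x | x <;> simp at hi hj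
    · rcases e with e | e | x | x | x <;> simp at hi hj
    · have hij' : i ≠ j := fun h => hij (by rw [h])
      rcases e with e | e | x | x | x <;> simp at hi hj
      exact hij' (hi.symm.trans hj)

end join

end MultiDigraph

namespace MultiDigraph

/-- merging edges of two path systems -/
def MSet (G : MultiDigraph) {n m : ℕ} (α : Fin n → List G.E) (β : Fin m → List G.E) : Set G.E :=
  {e | ∃ a b f g, f ≠ g ∧ [f, e] <:+: α a ∧ [g, e] <:+: β b}

theorem pair_form {n B : ℕ} (h : MstarAtLeast ![n, n] B) :
    ∃ (G : MultiDigraph) (s r1 r2 : G.V), G.Acyclic ∧ G.MinCut s r1 n ∧ G.MinCut s r2 n ∧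
      ∀ (α β : Fin n → List G.E), G.MengerSystem s r1 n α → G.MengerSystem s r2 n β →
        B ≤ (G.MSet α β).ncard := by
  obtain ⟨G, S, R, ⟨hac, -, hcut⟩, hS, hB⟩ := h
  have h0 : G.MinCut (S 0) (R 0) n := hcut 0
  have h1 : G.MinCut (S 0) (R 1) n := by
    rw [hS 0 1]; exact hcut 1
  refine ⟨G, S 0, R 0, R 1, hac, h0, h1, ?_⟩
  intro α β hα hβ
  have := hB (fun j => match j with
    | 0 => α
    | 1 => β) (by
      intro i
      match i with
      | 0 => exact hα
      | 1 => rw [hS 1 0]; exact hβ)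
  refine this.trans ?_
  have := G.fintE
  refine Set.ncard_le_ncard ?_ (Set.toFinite _)
  rintro e ⟨i, j, hij, a, b, f, g, hfg, h1, h2⟩
  match i, j, a, b with
  | 0, 0, _, _ => exact absurd rfl hij
  | 1, 1, _, _ => exact absurd rfl hij
  | 0, 1, a, b => exact ⟨a, b, f, g, hfg, h1, h2⟩
  | 1, 0, a, b => exact ⟨b, a, g, f, hfg.symm, h2, h1⟩

theorem MinCut.ne {G : MultiDigraph} (hG : G.Acyclic) {u v : G.V} {n : ℕ} (hn : 0 < n)
    (h : G.MinCut u v n) : u ≠ v := by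
  rintro rfl
  obtain ⟨α, hα⟩ := h.1
  exact hG _ _ (hα.1 ⟨0, hn⟩)

theorem infix_map {α β : Type} (F : α → β) {f e : α} {l : List α} {l' : List β}
    (h : [f, e] <:+: l) (h' : l.map F <:+: l') : [F f, F e] <:+: l' :=
  List.IsInfix.trans (by simpa using h.map F) h'

theorem step {k : ℕ} (c : Fin (k + 2) → ℕ) (hpos : ∀ i, 0 < c i)
    (hle : c (Fin.last k).castSucc ≤ c (Fin.last (k + 1))) {B B' : ℕ}
    (h1 : MstarAtLeast (fun i : Fin (k + 1) => c i.castSucc) B)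
    (h2 : MstarAtLeast ![c (Fin.last k).castSucc, c (Fin.last k).castSucc] B') :
    MstarAtLeast c (B + B') := by
  classical
  obtain ⟨G, s, r1, r2, hG, hc1, hc2, hGB⟩ := pair_form h2
  obtain ⟨H, S', R, ⟨hH, hR, hcut⟩, hS, hHB⟩ := h1
  obtain ⟨S, rfl⟩ : ∃ S, S' = fun _ => S := ⟨S' 0, funext fun i => hS i 0⟩
  obtain ⟨d, hd⟩ := Nat.exists_eq_add_of_le hle
  have hSr : S ≠ R (Fin.last k) := (hcut (Fin.last k)).ne hH (hpos _)
  have hs1 : s ≠ r1 := hc1.ne hG (hpos _)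
  have hs2 : s ≠ r2 := hc2.ne hG (hpos _)
  generalize hn : c (Fin.last k).castSucc = n at *
  let K := J H G S (R (Fin.last k)) s r2 n d
  let R' : Fin (k + 2) → JV H G := Fin.lastCases (motive := fun _ => JV H G) .z
    (fun i => if i = Fin.last k then .g r1 else .h (R i))
  have hRl : R' (Fin.last (k + 1)) = .z := Fin.lastCases_last
  have hRc : ∀ i : Fin (k + 1), R' i.castSucc = if i = Fin.last k then .g r1 else .h (R i) :=
    fun i => Fin.lastCases_castSucc _
  have hRm : R' (Fin.last k).castSucc = .g r1 := by rw [hRc, if_pos rfl]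
  have hRh : ∀ i : Fin (k + 1), i ≠ Fin.last k → R' i.castSucc = .h (R i) :=
    fun i hi => by rw [hRc, if_neg hi]
  have hcl : H.MinCut S (R (Fin.last k)) n := by
    rw [← hn]; exact hcut (Fin.last k)
  obtain ⟨β0, hβ0⟩ := hcl.1
  obtain ⟨γ0, hγ0⟩ := hc1.1
  obtain ⟨γ1, hγ1⟩ := hc2.1
  refine ⟨K, fun _ => JV.h S, R', ⟨J_acyclic hH hG, ?_, ?_⟩, fun _ _ => rfl, ?_⟩
  · intro i j
    refine Fin.lastCases ?_ (fun i => ?_) i <;> refine Fin.lastCases ?_ (fun j => ?_) j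
    · intro _; rfl
    · rw [hRl, hRc]; split_ifs <;> intro h <;> cases h
    · rw [hRl, hRc]; split_ifs <;> intro h <;> cases h
    · rw [hRc, hRc]
      split_ifs with hi hj hj
      · intro _; rw [hi, hj]
      · intro h; cases h
      · intro h; cases h
      · intro h; rw [hR (JV.h.inj h)]
  · intro i
    refine Fin.lastCases ?_ (fun i => ?_) i
    · rw [hRl, hd]
      refine ⟨J_E3 hβ0 hγ1, ?_⟩
      rintro ⟨α, hα⟩
      have := (J_D3 hs2 hα).1
      omega
    · by_cases hi : i = Fin.last k
      · subst hi
        rw [hRm, hn]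
        refine ⟨⟨_, J_E2 hβ0 hγ0⟩, ?_⟩
        rintro ⟨α, hα⟩
        have := (J_D2 hSr hs1 hα).1
        omega
      · rw [hRh i hi]
        obtain ⟨⟨β, hβ⟩, hno⟩ := hcut i
        refine ⟨⟨_, J_E1 hβ⟩, ?_⟩
        rintro ⟨α, hα⟩
        obtain ⟨β, hβ, -⟩ := J_D1 hα
        exact hno ⟨β, hβ⟩
  · intro α hα
    have hm := hα (Fin.last k).castSucc
    rw [hRm] at hm
    obtain ⟨-, βm, γm, hβm, hγm, hiβ, hiγ⟩ := J_D2 hSr hs1 hm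
    have hl := hα (Fin.last (k + 1))
    rw [hRl] at hl
    obtain ⟨γl, hγl, hil⟩ := (J_D3 hs2 hl).2 hd
    have hex : ∀ i : Fin (k + 1), ∃ β : Fin (c i.castSucc) → List H.E,
        H.MengerSystem S (R i) (c i.castSucc) β ∧
        ∀ x, (β x).map JE.h <:+: α i.castSucc x := by
      intro i
      by_cases hi : i = Fin.last k
      · subst hi
        exact ⟨βm, hβm, hiβ⟩
      · have h := hα i.castSucc
        rw [hRh i hi] at h
        obtain ⟨β, hβ, he⟩ := J_D1 h
        exact ⟨β, hβ, fun x => by rw [he]⟩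
    choose β hβ hβi using hex
    have b1 := hHB β hβ
    have b2 : B' ≤ (G.MSet γm γl).ncard := by
      subst hn
      exact hGB γm γl hγm hγl
    have := K.fintE
    have hinjh : Function.Injective (JE.h : H.E → JE H G n d) := fun _ _ h => JE.h.inj h
    have hinjg : Function.Injective (JE.g : G.E → JE H G n d) := fun _ _ h => JE.g.inj h
    let A1 : Set (JE H G n d) := JE.h '' {e | H.MergingEdge β e}
    let A2 : Set (JE H G n d) := JE.g '' G.MSet γm γl
    have hsub : A1 ∪ A2 ⊆ {e | K.MergingEdge α e} := by
      rintro _ (⟨e, ⟨i, j, hij, a, b, f, g, hfg, h1, h2⟩, rfl⟩ | ⟨e, ⟨a, b, f, g, hfg, h1, h2⟩, rfl⟩)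
      · exact ⟨i.castSucc, j.castSucc, fun h => hij (Fin.castSucc_injective _ h), a, b, JE.h f, JE.h g,
          fun h => hfg (hinjh h), infix_map _ h1 (hβi i a), infix_map _ h2 (hβi j b)⟩
      · obtain ⟨x, hx⟩ := hil b
        exact ⟨(Fin.last k).castSucc, Fin.last (k + 1), (Fin.castSucc_lt_last _).ne, a, x,
          JE.g f, JE.g g, fun h => hfg (hinjg h), infix_map _ h1 (hiγ a), infix_map _ h2 hx⟩
    have hdis : Disjoint A1 A2 := by
      rw [Set.disjoint_left]
      rintro _ ⟨e, -, rfl⟩ ⟨e', -, h⟩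
      cases h
    have hfin : ∀ A : Set (JE H G n d), A.Finite := fun A => @Set.toFinite _ A (@Subtype.finite _ (@Finite.of_fintype _ K.fintE) _)
    calc B + B' ≤ A1.ncard + A2.ncard := by
          rw [Set.ncard_image_of_injective _ hinjh, Set.ncard_image_of_injective _ hinjg]
          exact Nat.add_le_add b1 b2
      _ = (A1 ∪ A2).ncard := (Set.ncard_union_eq hdis (hfin _) (hfin _)).symm
      _ ≤ K.mergingCount α := Set.ncard_le_ncard hsub (hfin _)

theorem main_atLeast (k : ℕ) : ∀ (c : Fin (k + 1) → ℕ), (∀ i, 0 < c i) → Monotone c →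
    MstarAtLeast c (∑ i : Fin k, MstarNum ![c i.castSucc, c i.castSucc]) := by
  induction k with
  | zero => intro c _ _; simpa using star_atLeast c
  | succ k ih =>
    intro c hpos hmono
    rw [Fin.sum_univ_castSucc]
    refine step c hpos (hmono (Fin.le_last _)) ?_ (mstarAtLeast_of_zero (star_atLeast _))
    exact ih (fun i => c i.castSucc) (fun i => hpos _)
      (fun i j hij => hmono (Fin.castSucc_le_castSucc_iff.2 hij))

end MultiDigraph

/-- For all positive integers `n₁ ≤ n₂ ≤ … ≤ n_k`,
`M*(n₁, n₂, …, n_k) ≥ Σ_{i=1}^{k-1} M*(n_i, n_i)`.  Here the `k` min-cuts are given by a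
monotone function `c : Fin (k+1) → ℕ` (so the number of pairs is `k + 1 ≥ 1`). -/
theorem Mstar_superadditive (k : ℕ) (c : Fin (k + 1) → ℕ) (hpos : ∀ i, 0 < c i)
    (hmono : Monotone c) :
    ∑ i : Fin k, MstarNum ![c i.castSucc, c i.castSucc] ≤ MstarNum c := by
  exact le_mstar (main_atLeast k c hpos hmono)
end

section
/- In a non-reroutable (m,n)-graph G with distinct sources, any path pair (φ_a, ψ_b) occurs at most once in any given AA-sequence; that is, no AA-sequence visits two distinct merged subpaths both shared by the same φ-path and the same ψ-path. -/
namespace MultiDigraph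

/-- The Menger path system `α` from `u` to `v` is the unique one (as a set of paths):
the group `α` is not reroutable. -/
def NonReroutable (G : MultiDigraph) (u v : G.V) (c : ℕ) (α : Fin c → List G.E) : Prop :=
  ∀ β : Fin c → List G.E, G.MengerSystem u v c β → Set.range β = Set.range α

end MultiDigraph

open MultiDigraph

/-- The block `s` occurs on the path `p` (as a contiguous subpath) strictly before the
block `t`. -/
def OrderedOn {E : Type} (p s t : List E) : Prop :=
  ∃ u v w, p = u ++ s ++ v ++ t ++ w

/-- `s` is a merging (a maximal merged subpath) of the paths `p` and `q`: a nonempty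
common contiguous subpath, whose first edge is immediately preceded on `p` and on `q` by
two distinct edges, and which cannot be extended forward as a common subpath. -/
def MergedSub {E : Type} (p q s : List E) : Prop :=
  s ≠ [] ∧ s <:+: p ∧ s <:+: q ∧
    (∃ f g, f ≠ g ∧ (f :: s) <:+: p ∧ (g :: s) <:+: q) ∧
    ∀ e, ¬((s ++ [e]) <:+: p ∧ (s ++ [e]) <:+: q)

/-- `s` is the starting subpath of the paths `p` and `q`: a nonempty maximal common
prefix. -/
def StartSub {E : Type} (p q s : List E) : Prop :=
  s ≠ [] ∧ s <+: p ∧ s <+: q ∧ ∀ e, ¬((s ++ [e]) <+: p ∧ (s ++ [e]) <+: q)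

/-- `G` together with `φ` and `ψ` is a non-reroutable `(m, n)`-graph: `G` is acyclic, the
sinks are distinct, the min-cut from `S₁` to `R₁` is `m` and from `S₂` to `R₂` is `n`,
`φ` and `ψ` are Menger path systems for the two pairs covering all edges of `G`, and both
systems are unique (non-reroutable). -/
def MNGraph (G : MultiDigraph) (S1 S2 R1 R2 : G.V) (m n : ℕ)
    (φ : Fin m → List G.E) (ψ : Fin n → List G.E) : Prop :=
  G.Acyclic ∧ R1 ≠ R2 ∧ G.MinCut S1 R1 m ∧ G.MinCut S2 R2 n ∧
    G.MengerSystem S1 R1 m φ ∧ G.MengerSystem S2 R2 n ψ ∧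
    (∀ e : G.E, (∃ i, e ∈ φ i) ∨ ∃ j, e ∈ ψ j) ∧
    G.NonReroutable S1 R1 m φ ∧ G.NonReroutable S2 R2 n ψ

/-- A visit of the alternating (AA) procedure: a triple `(a, b, s)` recording the merged
(or starting) subpath `s` together with its associated path pair `(φ_a, ψ_b)`. -/
abbrev Visit (G : MultiDigraph) (m n : ℕ) := Fin m × Fin n × List G.E

section AA

variable {G : MultiDigraph} {m n : ℕ}

/-- The visit `v` is a merged subpath of the pair `(φ_{v.1}, ψ_{v.2.1})`. -/
def MS (φ : Fin m → List G.E) (ψ : Fin n → List G.E) (v : Visit G m n) : Prop :=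
  MergedSub (φ v.1) (ψ v.2.1) v.2.2

/-- Identical-sources variant: the visit `v` is a merged subpath, or the starting subpath
shared by `φ_a` and `ψ_a` (common source, paired starting subpaths). -/
def MSI (φ ψ : Fin m → List G.E) (v : Visit G m m) : Prop :=
  MS φ ψ v ∨ (v.1 = v.2.1 ∧ StartSub (φ v.1) (ψ v.1) v.2.2)

/-- One step of the AA procedure going forward along the φ-path associated with `v`:
`w` is the first visit on `φ_{v.1}` strictly after `v`. -/
def StepAlong (φ : Fin m → List G.E) (P : Visit G m n → Prop) (v w : Visit G m n) : Prop :=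
  w.1 = v.1 ∧ P w ∧ OrderedOn (φ v.1) v.2.2 w.2.2 ∧
    ∀ u, P u → u.1 = v.1 →
      ¬(OrderedOn (φ v.1) v.2.2 u.2.2 ∧ OrderedOn (φ v.1) u.2.2 w.2.2)

/-- One step of the AA procedure going backward against the ψ-path associated with `v`:
`w` is the nearest visit on `ψ_{v.2.1}` strictly before `v`. -/
def StepAgainst (ψ : Fin n → List G.E) (P : Visit G m n → Prop) (v w : Visit G m n) : Prop :=
  w.2.1 = v.2.1 ∧ P w ∧ OrderedOn (ψ v.2.1) w.2.2 v.2.2 ∧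
    ∀ u, P u → u.2.1 = v.2.1 →
      ¬(OrderedOn (ψ v.2.1) w.2.2 u.2.2 ∧ OrderedOn (ψ v.2.1) u.2.2 v.2.2)

/-- There is no visit after `v` on its φ-path (the forward walk reaches `R₁`). -/
def NoNextAlong (φ : Fin m → List G.E) (P : Visit G m n → Prop) (v : Visit G m n) : Prop :=
  ∀ u, P u → u.1 = v.1 → ¬ OrderedOn (φ v.1) v.2.2 u.2.2

/-- There is no visit before `v` on its ψ-path (the backward walk reaches `S₂`). -/
def NoNextAgainst (ψ : Fin n → List G.E) (P : Visit G m n → Prop) (v : Visit G m n) : Prop :=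
  ∀ u, P u → u.2.1 = v.2.1 → ¬ OrderedOn (ψ v.2.1) u.2.2 v.2.2

/-- `AAChain φ ψ P dir v L` : starting from the visit `v`, the alternating procedure
(next step backward against a ψ-path if `dir = true`, forward along a φ-path if
`dir = false`) visits exactly the list `L` of further visits and then terminates. -/
inductive AAChain (φ : Fin m → List G.E) (ψ : Fin n → List G.E) (P : Visit G m n → Prop) :
    Bool → Visit G m n → List (Visit G m n) → Prop
  | stopAgainst (v : Visit G m n) : NoNextAgainst ψ P v → AAChain φ ψ P true v []
  | stopAlong (v : Visit G m n) : NoNextAlong φ P v → AAChain φ ψ P false v []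
  | consAgainst (v w : Visit G m n) (rest : List (Visit G m n)) :
      StepAgainst ψ P v w → AAChain φ ψ P false w rest → AAChain φ ψ P true v (w :: rest)
  | consAlong (v w : Visit G m n) (rest : List (Visit G m n)) :
      StepAlong φ P v w → AAChain φ ψ P true w rest → AAChain φ ψ P false v (w :: rest)

/-- `L` is the `φ_i`-AA-sequence: either `φ_i` carries no visit and `L` is empty, or `L`
starts with the first visit on `φ_i` (go along `φ_i` from `S₁` to the first merged
subpath) and then alternates: against the associated ψ-path, along the associated φ-path,
and so on, until termination.  Its length is the number of merged subpaths visited. -/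
def IsPhiAA (φ : Fin m → List G.E) (ψ : Fin n → List G.E) (P : Visit G m n → Prop)
    (i : Fin m) (L : List (Visit G m n)) : Prop :=
  (L = [] ∧ ∀ u, P u → u.1 ≠ i) ∨
    ∃ v rest, L = v :: rest ∧ v.1 = i ∧ P v ∧
      (∀ u, P u → u.1 = i → ¬ OrderedOn (φ i) u.2.2 v.2.2) ∧
      AAChain φ ψ P true v rest

/-- `L` is the `ψ_j`-AA-sequence: either `ψ_j` carries no visit and `L` is empty, or `L`
starts with the last visit on `ψ_j` (go against `ψ_j` from `R₂` to the first merged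
subpath encountered) and then alternates: along the associated φ-path, against the
associated ψ-path, and so on, until termination. -/
def IsPsiAA (φ : Fin m → List G.E) (ψ : Fin n → List G.E) (P : Visit G m n → Prop)
    (j : Fin n) (L : List (Visit G m n)) : Prop :=
  (L = [] ∧ ∀ u, P u → u.2.1 ≠ j) ∨
    ∃ v rest, L = v :: rest ∧ v.2.1 = j ∧ P v ∧
      (∀ u, P u → u.2.1 = j → ¬ OrderedOn (ψ j) v.2.2 u.2.2) ∧
      AAChain φ ψ P false v rest

end AA


namespace PPair

section lists
variable {E : Type}

theorem pos_unique {a b a' b' : List E} {e : E} (hn : (a ++ e :: b).Nodup)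
    (h : a ++ e :: b = a' ++ e :: b') : a = a' ∧ b = b' := by
  induction a generalizing a' with
  | nil =>
    cases a' with
    | nil => simpa using h
    | cons x t =>
      simp only [List.nil_append, List.cons_append, List.cons.injEq] at h
      obtain ⟨rfl, rfl⟩ := h
      simp at hn
  | cons y l ih =>
    cases a' with
    | nil =>
      simp only [List.nil_append, List.cons_append, List.cons.injEq] at h
      obtain ⟨rfl, rfl⟩ := h
      simp at hn
    | cons x t =>
      simp only [List.cons_append, List.cons.injEq] at h
      obtain ⟨rfl, h⟩ := h
      have := ih (by simp only [List.cons_append, List.nodup_cons] at hn; exact hn.2) h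
      simp [this]

theorem dup_decomp {p : List E} (h : ¬ p.Nodup) :
    ∃ a e b c, p = a ++ (e :: b) ++ (e :: c) := by
  induction p with
  | nil => simp at h
  | cons x l ih =>
    by_cases hx : x ∈ l
    · obtain ⟨b, c, rfl⟩ := List.append_of_mem hx
      exact ⟨[], x, b, c, by simp⟩
    · have : ¬ l.Nodup := fun h' => h (List.nodup_cons.2 ⟨hx, h'⟩)
      obtain ⟨a, e, b, c, rfl⟩ := ih this
      exact ⟨x :: a, e, b, c, by simp⟩

theorem first_decomp {P : E → Prop} {l : List E} (h : ∃ e ∈ l, P e) :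
    ∃ a e b, l = a ++ e :: b ∧ P e ∧ ∀ x ∈ a, ¬ P x := by
  induction l with
  | nil => simp at h
  | cons x l ih =>
    by_cases hx : P x
    · exact ⟨[], x, l, by simp, hx, by simp⟩
    · obtain ⟨e, he, hp⟩ := h
      have : e ∈ l := by
        rcases List.mem_cons.1 he with rfl | h'
        · exact absurd hp hx
        · exact h'
      obtain ⟨a, e, b, rfl, h1, h2⟩ := ih ⟨e, this, hp⟩
      refine ⟨x :: a, e, b, by simp, h1, ?_⟩
      intro y hy
      rcases List.mem_cons.1 hy with rfl | h'
      · exact hx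
      · exact h2 y h'

theorem common_prefix (P Q : List E) : ∃ s P' Q', P = s ++ P' ∧ Q = s ++ Q' ∧
    ∀ h, ¬ (P'.head? = some h ∧ Q'.head? = some h) := by
  induction P generalizing Q with
  | nil => exact ⟨[], [], Q, by simp, by simp, by simp⟩
  | cons x P ih =>
    cases Q with
    | nil => exact ⟨[], x :: P, [], by simp, by simp, by simp⟩
    | cons y Q =>
      by_cases hxy : x = y
      · subst hxy
        obtain ⟨s, P', Q', rfl, rfl, h⟩ := ih Q
        exact ⟨x :: s, P', Q', by simp, by simp, h⟩
      · refine ⟨[], x :: P, y :: Q, by simp, by simp, ?_⟩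
        rintro h ⟨h1, h2⟩
        simp at h1 h2
        exact hxy (h1.trans h2.symm)

theorem MergedSub.symm' {p q s : List E} (h : MergedSub p q s) : MergedSub q p s := by
  obtain ⟨h1, h2, h3, ⟨f, g, h4, h5, h6⟩, h7⟩ := h
  exact ⟨h1, h3, h2, ⟨g, f, h4.symm, h6, h5⟩, fun e he => h7 e ⟨he.2, he.1⟩⟩

theorem pred_unique {p : List E} (hp : p.Nodup) {f h e : E} {s : List E}
    (h1 : (f :: e :: s) <:+: p) (h2 : [h, e] <:+: p) : f = h := by
  obtain ⟨a, b, rfl⟩ := h1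
  obtain ⟨c, d, hd⟩ := h2
  have := pos_unique (a := a ++ [f]) (e := e) (b := s ++ b) (a' := c ++ [h]) (b' := d)
    (by simpa using hp) (by simpa using hd.symm)
  simpa using (List.append_inj' this.1 rfl).2

theorem noshared {p q v' : List E} {h t : E} (hp : p.Nodup) (hq : q.Nodup)
    (hm : MergedSub p q (t :: v')) (h1 : [h, t] <:+: p) (h2 : [h, t] <:+: q) : False := by
  obtain ⟨-, -, -, ⟨f, g, h4, h5, h6⟩, -⟩ := hm
  exact h4 ((pred_unique hp h5 h1).trans (pred_unique hq h6 h2).symm)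

theorem maxext {p q P0 P1 Q0 Q1 : List E} {f g e : E} (hp : p.Nodup) (hq : q.Nodup)
    (h1 : p = P0 ++ g :: e :: P1) (h2 : q = Q0 ++ f :: e :: Q1) (hfg : f ≠ g) :
    ∃ s P2, P1 = s ++ P2 ∧ MergedSub p q (e :: s) := by
  obtain ⟨s, P2, Q2, rfl, rfl, h⟩ := common_prefix P1 Q1
  refine ⟨s, P2, rfl, by simp, ⟨P0 ++ [g], P2, by simp [h1]⟩, ⟨Q0 ++ [f], Q2, by simp [h2]⟩,
    ⟨g, f, hfg.symm, ⟨P0, P2, by simp [h1]⟩, ⟨Q0, Q2, by simp [h2]⟩⟩, ?_⟩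
  rintro x ⟨⟨a, b, hab⟩, ⟨c, d, hcd⟩⟩
  have e1 := pos_unique (a := P0 ++ [g]) (e := e) (b := s ++ P2) (a' := a) (b' := s ++ [x] ++ b)
    (by simpa [h1] using hp) (by simpa [h1] using hab.symm)
  have e2 := pos_unique (a := Q0 ++ [f]) (e := e) (b := s ++ Q2) (a' := c) (b' := s ++ [x] ++ d)
    (by simpa [h2] using hq) (by simpa [h2] using hcd.symm)
  refine h x ⟨?_, ?_⟩
  · have := e1.2; simp at this; simp [this]
  · have := e2.2; simp at this; simp [this]

theorem exists_last {l : List E} (h : l ≠ []) : ∃ a e, l = a ++ [e] :=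
  ⟨l.dropLast, l.getLast h, (List.dropLast_append_getLast h).symm⟩

theorem infix_trans {a b c : List E} (h : a <:+: b) (h' : b <:+: c) : a <:+: c := h.trans h'

theorem orderedOn_irrefl {p s : List E} (hp : p.Nodup) (hs : s ≠ []) : ¬ OrderedOn p s s := by
  rintro ⟨u, v, w, rfl⟩
  obtain ⟨a, e, rfl⟩ := exists_last hs
  have := pos_unique (a := u ++ a) (e := e) (b := v ++ a ++ e :: w) (a' := u ++ a ++ e :: (v ++ a))
    (b' := w) (by simpa using hp) (by simp)
  have := congrArg List.length this.1
  simp at this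

/-- half of the trichotomy -/
theorem tri_half {k : ℕ} {β : Fin k → List E}
    (hdis : ∀ i j, i ≠ j → ∀ e, e ∈ β i → e ∉ β j) (hnd : ∀ i, (β i).Nodup)
    {p s t x y z y' : List E} {c d : Fin k} (hp : p.Nodup)
    (hs : MergedSub p (β c) s) (ht : MergedSub p (β d) t)
    (h1 : p = x ++ s ++ y) (h2 : p = x ++ z ++ t ++ y') :
    (s = t ∧ c = d) ∨ OrderedOn p s t := by
  have hcd : ∀ e, e ∈ β c → e ∈ β d → c = d := by
    intro e hc hd
    by_contra hne
    exact hdis c d hne e hc hd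
  obtain ⟨t0, t', rfl⟩ := List.exists_cons_of_ne_nil ht.1
  obtain ⟨s0, s', rfl⟩ := List.exists_cons_of_ne_nil hs.1
  have h3 : (s0 :: s') ++ y = z ++ ((t0 :: t') ++ y') := by
    have := h1.symm.trans h2
    simpa using this
  have ht0 : t0 ∈ β d := ht.2.2.1.subset (by simp)
  rcases List.append_eq_append_iff.1 h3 with ⟨k, hk, hk'⟩ | ⟨k, hk, hk'⟩
  · right
    exact ⟨x, k, y', by rw [h2, hk]; simp⟩
  · rcases List.eq_nil_or_concat' z with rfl | ⟨z', h, rfl⟩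
    · left
      simp only [List.nil_append] at h3 hk
      subst hk
      have hs0 : s0 = t0 := by simp at h3; exact h3.1
      subst hs0
      have hc : c = d := hcd s0 (hs.2.2.1.subset (by simp)) ht0
      subst hc
      refine ⟨?_, rfl⟩
      rcases List.append_eq_append_iff.1 hk' with ⟨l, hl, hl'⟩ | ⟨l, hl, hl'⟩
      · cases l with
        | nil => simpa using hl
        | cons e l =>
          exfalso
          refine ht.2.2.2.2 e ⟨infix_trans ?_ hs.2.1, infix_trans ?_ hs.2.2.1⟩ <;>
          · rw [hl]; exact ⟨[], l, by simp⟩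
      · cases l with
        | nil => simpa using hl.symm
        | cons e l =>
          exfalso
          refine hs.2.2.2.2 e ⟨infix_trans ?_ ht.2.1, infix_trans ?_ ht.2.2.1⟩ <;>
          · rw [hl]; exact ⟨[], l, by simp⟩
    · cases k with
      | nil =>
        right
        refine ⟨x, [], y', by rw [h2]; simp at hk; simp [hk]⟩
      | cons k0 k =>
        exfalso
        have hk0 : t0 = k0 := by simp at hk'; exact hk'.1
        subst hk0
        have hi : [h, t0] <:+: s0 :: s' := ⟨z', k, by simp [hk]⟩
        have hc : c = d := hcd t0 ((infix_trans hi hs.2.2.1).subset (by simp)) ht0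
        subst hc
        exact noshared hp (hnd _) ht (infix_trans hi hs.2.1) (infix_trans hi hs.2.2.1)

theorem tri {k : ℕ} {β : Fin k → List E}
    (hdis : ∀ i j, i ≠ j → ∀ e, e ∈ β i → e ∉ β j) (hnd : ∀ i, (β i).Nodup)
    {p s t : List E} {c d : Fin k} (hp : p.Nodup)
    (hs : MergedSub p (β c) s) (ht : MergedSub p (β d) t) :
    (s = t ∧ c = d) ∨ OrderedOn p s t ∨ OrderedOn p t s := by
  obtain ⟨x, y, h1⟩ := hs.2.1
  obtain ⟨x', y', h2⟩ := ht.2.1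
  have h3 : x ++ (s ++ y) = x' ++ (t ++ y') := by
    simpa using h1.trans h2.symm
  rcases List.append_eq_append_iff.1 h3 with ⟨z, hz, -⟩ | ⟨z, hz, -⟩
  · subst hz
    rcases tri_half hdis hnd hp hs ht h1.symm h2.symm with h | h
    · exact Or.inl h
    · exact Or.inr (Or.inl h)
  · subst hz
    rcases tri_half hdis hnd hp ht hs h2.symm h1.symm with h | h
    · exact Or.inl ⟨h.1.symm, h.2.symm⟩
    · exact Or.inr (Or.inr h)

end lists

open Relation

section graph

def adj (G : MultiDigraph) (u v : G.V) : Prop := ∃ e, G.src e = u ∧ G.dst e = v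

def hd (G : MultiDigraph) (o : G.V) (s : List G.E) : G.V := (s.head?.map G.src).getD o
def tl (G : MultiDigraph) (o : G.V) (s : List G.E) : G.V := (s.getLast?.map G.dst).getD o

theorem hd_cons (G : MultiDigraph) (o : G.V) (e : G.E) (s : List G.E) :
    hd G o (e :: s) = G.src e := rfl

theorem tl_concat (G : MultiDigraph) (o : G.V) (e : G.E) (s : List G.E) :
    tl G o (s ++ [e]) = G.dst e := by simp [tl]

def ch (G : MultiDigraph) (p : List G.E) : Prop :=
  List.IsChain (fun e f => G.dst e = G.src f) p

theorem ch_infix {G : MultiDigraph} {p q : List G.E} (h : ch G q) (hi : p <:+: q) : ch G p :=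
  List.IsChain.infix h hi

theorem ch_append {G : MultiDigraph} {o : G.V} {p q : List G.E} (h : ch G (p ++ q))
    (hp : p ≠ []) (hq : q ≠ []) : tl G o p = hd G o q := by
  obtain ⟨a, e, rfl⟩ := exists_last hp
  obtain ⟨f, b, rfl⟩ := List.exists_cons_of_ne_nil hq
  rw [tl_concat, hd_cons]
  have := ch_infix h (p := [e, f]) ⟨a, b, by simp⟩
  simpa [ch] using this

theorem walk {G : MultiDigraph} {o : G.V} {r : G.V → G.V → Prop} {l : List G.E} (h : ch G l)
    (hl : l ≠ []) (hr : ∀ e ∈ l, r (G.src e) (G.dst e)) : TransGen r (hd G o l) (tl G o l) := by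
  induction l with
  | nil => exact absurd rfl hl
  | cons e l ih =>
    by_cases hl' : l = []
    · subst hl'
      exact TransGen.single (hr e (by simp))
    · have h1 := ih (ch_infix h ⟨[e], [], by simp⟩) hl' (fun x hx => hr x (by simp [hx]))
      have h2 : tl G o [e] = hd G o l := ch_append (p := [e]) h (by simp) hl'
      have h3 : tl G o (e :: l) = tl G o l := by
        obtain ⟨a, f, rfl⟩ := exists_last hl'
        rw [tl_concat, ← List.cons_append, tl_concat]
      rw [h3]
      refine TransGen.head (b := hd G o l) ?_ h1
      rw [← h2]
      exact hr e (by simp)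

theorem walkR {G : MultiDigraph} {o : G.V} {r : G.V → G.V → Prop} {w l v : List G.E}
    (h : ch G (w ++ l ++ v)) (hw : w ≠ []) (hv : v ≠ [])
    (hr : ∀ e ∈ l, r (G.src e) (G.dst e)) : ReflTransGen r (tl G o w) (hd G o v) := by
  by_cases hl : l = []
  · subst hl
    rw [ch_append (o := o) (p := w) (q := v) (by simpa using h) hw hv]
  · rw [ch_append (o := o) (p := w) (q := l) (ch_infix h ⟨[], v, by simp⟩) hw hl,
      ← ch_append (o := o) (p := l) (q := v) (ch_infix h ⟨w, [], by simp⟩) hl hv]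
    exact (walk (ch_infix h ⟨w, v, by simp⟩) hl hr).to_reflTransGen

theorem walkT {G : MultiDigraph} {o : G.V} {r : G.V → G.V → Prop} {w l v : List G.E}
    (h : ch G (w ++ l ++ v)) (hw : w ≠ []) (hv : v ≠ []) (hl : l ≠ [])
    (hr : ∀ e ∈ l, r (G.src e) (G.dst e)) : TransGen r (tl G o w) (hd G o v) := by
  rw [ch_append (o := o) (p := w) (q := l) (ch_infix h ⟨[], v, by simp⟩) hw hl,
      ← ch_append (o := o) (p := l) (q := v) (ch_infix h ⟨w, [], by simp⟩) hl hv]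
  exact walk (ch_infix h ⟨w, v, by simp⟩) hl hr

theorem path_iff {G : MultiDigraph} (o : G.V) {u v : G.V} {p : List G.E} :
    G.IsPathFrom u v p ↔ p ≠ [] ∧ ch G p ∧ hd G o p = u ∧ tl G o p = v := by
  unfold MultiDigraph.IsPathFrom
  constructor
  · rintro ⟨h1, h2, h3, h4⟩
    refine ⟨h1, h2, ?_, ?_⟩
    · obtain ⟨e, l, rfl⟩ := List.exists_cons_of_ne_nil h1
      exact h3 e (by simp)
    · obtain ⟨a, e, rfl⟩ := exists_last h1
      rw [tl_concat]
      exact h4 e (by simp)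
  · rintro ⟨h1, h2, h3, h4⟩
    refine ⟨h1, h2, ?_, ?_⟩
    · obtain ⟨e, l, rfl⟩ := List.exists_cons_of_ne_nil h1
      intro x hx
      simp at hx
      rw [← hx]; exact h3
    · obtain ⟨a, e, rfl⟩ := exists_last h1
      intro x hx
      simp at hx
      rw [← hx, ← h4, tl_concat]

theorem path_snoc {G : MultiDigraph} {u v : G.V} {p : List G.E} (h : G.IsPathFrom u v p)
    {e : G.E} (he : G.src e = v) : G.IsPathFrom u (G.dst e) (p ++ [e]) := by
  rw [path_iff u] at h ⊢
  obtain ⟨h1, h2, h3, h4⟩ := h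
  refine ⟨by simp, ?_, ?_, tl_concat _ _ _ _⟩
  · obtain ⟨a, f, rfl⟩ := exists_last h1
    rw [tl_concat] at h4
    have : List.IsChain (fun e f => G.dst e = G.src f) (a ++ f :: e :: []) := by
      rw [List.isChain_append_cons_cons]
      exact ⟨h2, h4.trans he.symm, by simp⟩
    simpa [ch] using this
  · obtain ⟨f, a, rfl⟩ := List.exists_cons_of_ne_nil h1
    exact h3

theorem path_single {G : MultiDigraph} (e : G.E) : G.IsPathFrom (G.src e) (G.dst e) [e] := by
  simp [MultiDigraph.IsPathFrom, List.Chain']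

theorem path_of_trans {G : MultiDigraph} {u v : G.V} (h : TransGen (adj G) u v) :
    ∃ p, G.IsPathFrom u v p := by
  induction h with
  | single h =>
    obtain ⟨e, rfl, rfl⟩ := h
    exact ⟨[e], path_single e⟩
  | tail _ h ih =>
    obtain ⟨e, h1, rfl⟩ := h
    obtain ⟨p, hp⟩ := ih
    exact ⟨p ++ [e], path_snoc hp h1⟩

theorem ac_trans {G : MultiDigraph} (h : G.Acyclic) (v : G.V) : ¬ TransGen (adj G) v v := by
  intro h'
  obtain ⟨p, hp⟩ := path_of_trans h'
  exact h v p hp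

theorem ac_nodup {G : MultiDigraph} (h : G.Acyclic) {p : List G.E} (hp : ch G p) : p.Nodup := by
  by_contra hn
  obtain ⟨a, e, b, c, rfl⟩ := dup_decomp hn
  have h1 := walk (o := G.src e) (r := adj G) (l := e :: b)
    (ch_infix hp ⟨a, e :: c, by simp⟩) (by simp) (fun x _ => ⟨x, rfl, rfl⟩)
  rw [ch_append (o := G.src e) (p := e :: b) (q := e :: c) (ch_infix hp ⟨a, [], by simp⟩)
    (by simp) (by simp)] at h1
  exact ac_trans h _ h1

/-- A closed walk can be shortened to one without repeated edges. -/
theorem closed_nodup {G : MultiDigraph} (n : ℕ) : ∀ (v : G.V) (p : List G.E), p.length ≤ n →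
    G.IsPathFrom v v p → ∃ u q, G.IsPathFrom u u q ∧ q.Nodup := by
  induction n with
  | zero =>
    intro v p hl hp
    exact absurd (List.length_eq_zero_iff.1 (Nat.le_zero.1 hl)) hp.1
  | succ n ih =>
    intro v p hl hp
    by_cases hn : p.Nodup
    · exact ⟨v, p, hp, hn⟩
    · obtain ⟨a, e, b, c, rfl⟩ := dup_decomp hn
      refine ih (G.src e) (e :: b) (by simp at hl ⊢; omega) ?_
      rw [path_iff v] at hp ⊢
      have hc := hp.2.1
      refine ⟨by simp, ch_infix hc ⟨a, e :: c, by simp⟩, rfl, ?_⟩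
      rw [ch_append (o := v) (p := e :: b) (q := e :: c) (ch_infix hc ⟨a, [], by simp⟩)
        (by simp) (by simp)]
      rfl

end graph

section flow

open Classical in
noncomputable def bd (G : MultiDigraph) (e : G.E) : G.V → ℤ :=
  Pi.single (G.src e) 1 - Pi.single (G.dst e) 1

open Classical in
theorem bd_path {G : MultiDigraph} {o : G.V} {p : List G.E} (h : ch G p) (hp : p ≠ []) :
    (p.map (bd G)).sum = Pi.single (hd G o p) 1 - Pi.single (tl G o p) 1 := by
  induction p with
  | nil => exact absurd rfl hp
  | cons e l ih =>
    by_cases hl' : l = []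
    · subst hl'
      simp [hd, tl, bd]
    · have h1 := ih (ch_infix h ⟨[e], [], by simp⟩) hl'
      have h2 : tl G o [e] = hd G o l := ch_append (p := [e]) h (by simp) hl'
      have h3 : tl G o (e :: l) = tl G o l := by
        obtain ⟨a, f, rfl⟩ := exists_last hl'
        rw [tl_concat, ← List.cons_append, tl_concat]
      rw [h3, List.map_cons, List.sum_cons, h1, ← h2, hd_cons]
      simp [bd, tl]

open Classical in
theorem exists_path {G : MultiDigraph} (hac : G.Acyclic) {S R : G.V} (hSR : S ≠ R)
    (F : Finset G.E) (m : ℕ)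
    (hF : ∑ e ∈ F, bd G e = ((m : ℤ) + 1) • (Pi.single S 1 - Pi.single R 1 : G.V → ℤ)) :
    ∃ p, G.IsPathFrom S R p ∧ ∀ e ∈ p, e ∈ F := by
  have key : ∀ v, v ≠ R → (v = S ∨ ∃ e ∈ F, G.dst e = v) → ∃ e ∈ F, G.src e = v := by
    intro v hvR hv
    by_contra hno
    push Not at hno
    have h1 := congrFun hF v
    rw [Finset.sum_apply] at h1
    have hle : ∀ e ∈ F, bd G e v ≤ 0 := by
      intro e he
      have := hno e he
      simp only [bd, Pi.sub_apply, Pi.single_apply]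
      rw [if_neg (fun h => this h.symm)]
      split_ifs <;> simp
    by_cases hvS : v = S
    · subst hvS
      have := Finset.sum_nonpos hle
      rw [h1] at this
      simp [Pi.single_apply, hSR] at this
      omega
    · have hex : ∃ e ∈ F, G.dst e = v := by tauto
      obtain ⟨e, he, hev⟩ := hex
      have h0 : ∑ c ∈ F, bd G c v < 0 := by
        refine Finset.sum_neg' hle ⟨e, he, ?_⟩
        have := hno e he
        simp only [bd, Pi.sub_apply, Pi.single_apply]
        rw [if_neg (fun h => this h.symm), if_pos hev.symm]
        norm_num
      rw [h1] at h0
      simp [Pi.single_apply, hvS, hvR] at h0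
  by_contra hcon
  have long : ∀ n : ℕ, ∃ v p, G.IsPathFrom S v p ∧ (∀ e ∈ p, e ∈ F) ∧ p.length = n + 1 := by
    intro n
    induction n with
    | zero =>
      obtain ⟨e, he, hs⟩ := key S hSR (Or.inl rfl)
      refine ⟨_, [e], hs ▸ path_single e, by simpa using he, rfl⟩
    | succ n ih =>
      obtain ⟨v, p, hp, hpF, hl⟩ := ih
      have hvR : v ≠ R := by
        rintro rfl
        exact hcon ⟨p, hp, hpF⟩
      have hv : ∃ e ∈ F, G.dst e = v := by
        have hp' := (path_iff S).1 hp
        obtain ⟨a, e, rfl⟩ := exists_last hp.1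
        refine ⟨e, hpF e (by simp), ?_⟩
        rw [← hp'.2.2.2, tl_concat]
      obtain ⟨e, he, hs⟩ := key v hvR (Or.inr hv)
      refine ⟨_, p ++ [e], path_snoc hp hs, ?_, by simp [hl]⟩
      intro x hx
      rcases List.mem_append.1 hx with h | h
      · exact hpF x h
      · simp at h; rw [h]; exact he
  obtain ⟨v, p, hp, -, hl⟩ := long F.card
  obtain ⟨v, p, hp, hpF, hl⟩ := long F.card
  have hnd : p.Nodup := ac_nodup hac hp.2.1
  have : p.toFinset.card ≤ F.card :=
    Finset.card_le_card (fun x hx => hpF x (by simpa using hx))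
  rw [List.toFinset_card_of_nodup hnd] at this
  omega

open Classical in
theorem flow_decomp {G : MultiDigraph} (hac : G.Acyclic) {S R : G.V} (hSR : S ≠ R) (m : ℕ) :
    ∀ F : Finset G.E,
    ∑ e ∈ F, bd G e = (m : ℤ) • (Pi.single S 1 - Pi.single R 1 : G.V → ℤ) →
    ∃ α : Fin m → List G.E, G.MengerSystem S R m α ∧ ∀ i, ∀ e ∈ α i, e ∈ F := by
  induction m with
  | zero =>
    intro F _
    exact ⟨fun i => i.elim0, ⟨fun i => i.elim0, fun i => i.elim0⟩, fun i => i.elim0⟩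
  | succ m ih =>
    intro F hF
    obtain ⟨p, hp, hpF⟩ := exists_path hac hSR F m (by simpa using hF)
    have hnd : p.Nodup := ac_nodup hac hp.2.1
    have hsub : p.toFinset ⊆ F := fun x hx => hpF x (by simpa using hx)
    have hp' := (path_iff S).1 hp
    have hsum : ∑ e ∈ p.toFinset, bd G e = Pi.single S 1 - Pi.single R 1 := by
      rw [List.sum_toFinset _ hnd, bd_path (o := S) hp'.2.1 hp.1, hp'.2.2.1, hp'.2.2.2]
    obtain ⟨α, hα, hαF⟩ := ih (F \ p.toFinset) (by
      have := Finset.sum_sdiff (f := bd G) hsub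
      rw [hsum, hF] at this
      rw [eq_sub_of_add_eq this]
      push_cast
      rw [add_smul, one_smul]
      abel)
    have hαp : ∀ i, ∀ e ∈ α i, e ∉ p := by
      intro i e he hep
      have := hαF i e he
      simp [hep] at this
    refine ⟨Fin.cons p α, ⟨?_, ?_⟩, ?_⟩
    · intro i
      refine Fin.cases ?_ (fun i => ?_) i
      · simpa using hp
      · simpa using hα.1 i
    · intro i j
      refine Fin.cases ?_ (fun i => ?_) i
      · refine Fin.cases ?_ (fun j => ?_) j
        · intro h; exact absurd rfl h
        · intro _ e he hej
          simp at he hej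
          exact hαp j e hej he
      · refine Fin.cases ?_ (fun j => ?_) j
        · intro _ e he hej
          simp at he hej
          exact hαp i e he hej
        · intro hij e he hej
          simp at he hej
          exact hα.2 i j (fun h => hij (by rw [h])) e he hej
    · intro i
      refine Fin.cases ?_ (fun i => ?_) i
      · simpa using hpF
      · intro e he
        have := hαF i e (by simpa using he)
        simp at this
        exact this.1

open Classical in
/-- Reverse all the edges outside of `Φ`. -/
noncomputable def fl (G : MultiDigraph) (Φ : Set G.E) : MultiDigraph where
  V := G.V
  E := G.E
  fintV := G.fintV
  fintE := G.fintE
  src := fun e => if e ∈ Φ then G.src e else G.dst e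
  dst := fun e => if e ∈ Φ then G.dst e else G.src e

theorem fl_src_pos {G : MultiDigraph} {Φ : Set G.E} {e : G.E} (h : e ∈ Φ) :
    (fl G Φ).src e = G.src e := if_pos h
theorem fl_dst_pos {G : MultiDigraph} {Φ : Set G.E} {e : G.E} (h : e ∈ Φ) :
    (fl G Φ).dst e = G.dst e := if_pos h
theorem fl_src_neg {G : MultiDigraph} {Φ : Set G.E} {e : G.E} (h : e ∉ Φ) :
    (fl G Φ).src e = G.dst e := if_neg h
theorem fl_dst_neg {G : MultiDigraph} {Φ : Set G.E} {e : G.E} (h : e ∉ Φ) :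
    (fl G Φ).dst e = G.src e := if_neg h

open Classical in
noncomputable def bd2 {V : Type} (a b : V) : V → ℤ := Pi.single a 1 - Pi.single b 1

theorem bd_fl_pos {G : MultiDigraph} {Φ : Set G.E} {e : G.E} (h : e ∈ Φ) :
    bd (fl G Φ) e = bd G e :=
  congrArg₂ (bd2 (V := G.V)) (fl_src_pos h) (fl_dst_pos h)

theorem bd_fl_neg {G : MultiDigraph} {Φ : Set G.E} {e : G.E} (h : e ∉ Φ) :
    bd (fl G Φ) e = - bd G e :=
  (congrArg₂ (bd2 (V := G.V)) (fl_src_neg h) (fl_dst_neg h)).trans (neg_sub _ _).symm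

/-- residual relation -/
def res (G : MultiDigraph) (Φ : Set G.E) (u v : G.V) : Prop :=
  ∃ e, (e ∈ Φ ∧ G.src e = u ∧ G.dst e = v) ∨ (e ∉ Φ ∧ G.dst e = u ∧ G.src e = v)

open Classical in
theorem res_acyclic {G : MultiDigraph} (hac : G.Acyclic) {S R : G.V} {m : ℕ}
    {φ : Fin m → List G.E} (hM : G.MengerSystem S R m φ) (hN : G.NonReroutable S R m φ)
    (v : G.V) : ¬ TransGen (res G {e | ∃ i, e ∈ φ i}) v v := by
  intro hv
  set Φ : Set G.E := {e | ∃ i, e ∈ φ i} with hΦ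
  have hv' : TransGen (adj (fl G Φ)) v v := by
    refine TransGen.mono ?_ _ _ hv
    rintro a b ⟨e, ⟨h1, h2, h3⟩ | ⟨h1, h2, h3⟩⟩
    · exact ⟨e, (fl_src_pos h1).trans h2, (fl_dst_pos h1).trans h3⟩
    · exact ⟨e, (fl_src_neg h1).trans h2, (fl_dst_neg h1).trans h3⟩
  obtain ⟨p, hp⟩ := path_of_trans hv'
  obtain ⟨u, q, hq, hqn⟩ := closed_nodup (G := fl G Φ) p.length v p le_rfl hp
  have hq' := (path_iff (G := fl G Φ) u).1 hq
  -- some edge of q is in Φ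
  have hex : ∃ e ∈ q, e ∈ Φ := by
    by_contra hno
    push Not at hno
    have := walk (G := fl G Φ) (o := u) (r := Function.swap (adj G)) hq'.2.1 hq.1 (by
      intro e he
      have hn := hno e he
      exact ⟨e, (fl_dst_neg hn).symm, (fl_src_neg hn).symm⟩)
    rw [hq'.2.2.1, hq'.2.2.2] at this
    exact ac_trans hac u (transGen_swap.1 this)
  obtain ⟨e0, he0q, he0⟩ := hex
  have hSR : S ≠ R := by
    rintro rfl
    obtain ⟨i, hi⟩ := he0
    exact hac _ _ (hM.1 i)
  letI := G.fintE
  let Q : Finset G.E := List.toFinset (α := G.E) q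
  let P : Finset G.E := Finset.univ.filter (· ∈ Φ)
  have hPsum : ∑ e ∈ P, bd G e = (m : ℤ) • (Pi.single S 1 - Pi.single R 1 : G.V → ℤ) := by
    have : P = Finset.univ.biUnion (fun i => (φ i).toFinset) := by
      ext e; simp [P, hΦ]
    rw [this, Finset.sum_biUnion]
    · rw [Finset.sum_congr rfl (g := fun _ => (Pi.single S 1 - Pi.single R 1 : G.V → ℤ))]
      · rw [Finset.sum_const, Finset.card_univ, Fintype.card_fin, natCast_zsmul]
      · intro i _
        have hi := (path_iff S).1 (hM.1 i)
        rw [List.sum_toFinset _ (ac_nodup hac hi.2.1), bd_path (o := S) hi.2.1 hi.1,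
          hi.2.2.1, hi.2.2.2]
    · intro i _ j _ hij
      rw [Function.onFun, Finset.disjoint_left]
      intro e he hej
      simp at he hej
      exact hM.2 i j hij e he hej
  have hQsum : ∑ e ∈ Q, bd (fl G Φ) e = 0 := by
    have h1 := bd_path (G := fl G Φ) (o := u) hq'.2.1 hq.1
    rw [hq'.2.2.1, hq'.2.2.2, sub_self] at h1
    rw [← h1]
    exact List.sum_toFinset _ hqn
  have hF : ∑ e ∈ (P \ Q) ∪ (Q \ P), bd G e
      = (m : ℤ) • (Pi.single S 1 - Pi.single R 1 : G.V → ℤ) := by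
    rw [Finset.sum_union (by
      rw [Finset.disjoint_left]; intro e h1 h2; simp at h1 h2; exact h2.2 h1.1)]
    have h1 : ∑ e ∈ P \ Q, bd G e + ∑ e ∈ P ∩ Q, bd G e = ∑ e ∈ P, bd G e := by
      rw [add_comm]; exact Finset.sum_inter_add_sum_sdiff P Q _
    have h2 : ∑ e ∈ Q ∩ P, bd (fl G Φ) e + ∑ e ∈ Q \ P, bd (fl G Φ) e
        = ∑ e ∈ Q, bd (fl G Φ) e := Finset.sum_inter_add_sum_sdiff Q P _
    have h3 : ∑ e ∈ Q ∩ P, bd (fl G Φ) e = ∑ e ∈ P ∩ Q, bd G e := by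
      rw [Finset.inter_comm]
      refine Finset.sum_congr rfl (fun e he => ?_)
      have : e ∈ Φ := by simp [P] at he; exact he.1
      exact bd_fl_pos this
    have h4 : ∑ e ∈ Q \ P, bd (fl G Φ) e = - ∑ e ∈ Q \ P, bd G e := by
      rw [← Finset.sum_neg_distrib]
      refine Finset.sum_congr rfl (fun e he => ?_)
      have : e ∉ Φ := by simp [P] at he; exact he.2
      exact bd_fl_neg this
    have h5 : ∑ e ∈ P ∩ Q, bd G e - ∑ e ∈ Q \ P, bd G e = 0 := by
      have h6 := h2
      rw [hQsum, h3, h4] at h6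
      rw [sub_eq_add_neg]; exact h6
    rw [← hPsum, ← h1, sub_eq_zero.1 h5]
  obtain ⟨α, hα, hαF⟩ := flow_decomp hac hSR m _ hF
  have hr := hN α hα
  obtain ⟨i, hi⟩ := he0
  have : φ i ∈ Set.range α := by rw [hr]; exact ⟨i, rfl⟩
  obtain ⟨j, hj⟩ := this
  have h1 := hαF j e0 (by rw [hj]; exact hi)
  have hPe : e0 ∈ P := (Finset.mem_filter (α := G.E)).2 ⟨Finset.mem_univ (α := G.E) _, i, hi⟩
  have hQe : e0 ∈ Q := List.mem_toFinset.2 he0q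
  rcases Finset.mem_union.1 h1 with h | h
  · exact (Finset.mem_sdiff.1 h).2 hQe
  · exact (Finset.mem_sdiff.1 h).2 hPe

end flow

section main

theorem gap_free {G : MultiDigraph} (hac : G.Acyclic) {S R : G.V} {k : ℕ}
    {β : Fin k → List G.E} (hM : G.MengerSystem S R k β) {p : List G.E} (hp : ch G p)
    {w v x gap y : List G.E} {c d : Fin k}
    (hw : MergedSub p (β c) w) (hv : MergedSub p (β d) v)
    (hpe : p = x ++ w ++ gap ++ v ++ y)
    (hno : ∀ c' s, MergedSub p (β c') s → ¬ (OrderedOn p w s ∧ OrderedOn p s v)) :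
    ∀ e ∈ gap, ∀ c', e ∉ β c' := by
  have hnd : ∀ i, (β i).Nodup := fun i => ac_nodup hac (hM.1 i).2.1
  have hpn : p.Nodup := ac_nodup hac hp
  have hcd : ∀ i j e, e ∈ β i → e ∈ β j → i = j := by
    intro i j e hc hd
    by_contra hne
    exact hM.2 i j hne e hc hd
  by_contra hcon
  push Not at hcon
  obtain ⟨g1, e, g2, hg, ⟨c', hc'⟩, hfirst⟩ := first_decomp (P := fun e => ∃ c', e ∈ β c') hcon
  subst hg
  obtain ⟨A, B, hAB⟩ := List.append_of_mem hc'
  rcases List.eq_nil_or_concat' A with rfl | ⟨A', f, rfl⟩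
  · -- `e` is the first edge of its path
    have hS : G.src e = S := by
      have := ((path_iff S).1 (hM.1 c')).2.2.1
      rw [hAB] at this
      exact this
    obtain ⟨X, Y, hXY⟩ := hw.2.2.1
    have hchc : ch G (β c) := (hM.1 c).2.1
    have h1 : ReflTransGen (adj G) S (hd G S w) := by
      have hS' := ((path_iff S).1 (hM.1 c)).2.2.1
      by_cases hX : X = []
      · subst hX
        obtain ⟨w0, w', rfl⟩ := List.exists_cons_of_ne_nil hw.1
        rw [← hXY] at hS'
        rw [hd_cons]
        change G.src w0 = S at hS'
        rw [hS']
      · obtain ⟨x0, X', rfl⟩ := List.exists_cons_of_ne_nil hX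
        rw [← hXY] at hS'
        change G.src x0 = S at hS'
        have := walk (o := S) (r := adj G) (l := x0 :: X')
          (ch_infix hchc ⟨[], w ++ Y, by simp [← hXY]⟩) (by simp) (fun e _ => ⟨e, rfl, rfl⟩)
        rw [ch_append (o := S) (p := x0 :: X') (q := w)
          (ch_infix hchc ⟨[], Y, by simp [← hXY]⟩) (by simp) hw.1, hd_cons, hS'] at this
        exact this.to_reflTransGen
    have h2 : TransGen (adj G) (hd G S w) (tl G S w) :=
      walk (ch_infix hchc hw.2.2.1) hw.1 (fun e _ => ⟨e, rfl, rfl⟩)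
    have h3 : ReflTransGen (adj G) (tl G S w) (hd G S (e :: g2)) :=
      walkR (l := g1) (ch_infix hp ⟨x, v ++ y, by simp [hpe]⟩) hw.1 (by simp)
        (fun e _ => ⟨e, rfl, rfl⟩)
    rw [hd_cons, hS] at h3
    exact ac_trans hac S ((TransGen.trans_right h1 h2).trans_left h3)
  · obtain ⟨W', g, hW⟩ := exists_last (l := w ++ g1) (by simp [hw.1])
    by_cases hfg : f = g
    · subst hfg
      have hfβ : f ∈ β c' := by rw [hAB]; simp
      have hg1 : g1 = [] := by
        by_contra hne
        obtain ⟨g', x', rfl⟩ := exists_last hne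
        have : x' = f := by
          rw [← List.append_assoc] at hW
          simpa using (List.append_inj' hW rfl).2
        subst this
        exact hfirst x' (by simp) ⟨c', hfβ⟩
      subst hg1
      simp only [List.append_nil] at hW
      subst hW
      have hcc : c = c' := hcd c c' f (hw.2.2.1.subset (by simp)) hfβ
      subst hcc
      obtain ⟨X, Y, hXY⟩ := hw.2.2.1
      have hu := pos_unique (a := X ++ W') (e := f) (b := Y) (a' := A') (b' := e :: B)
        (by have := hnd c; rw [← hXY] at this; simpa using this)
        (by have := hXY.trans hAB; simpa using this)
      refine hw.2.2.2.2 e ⟨⟨x, g2 ++ v ++ y, by simp [hpe]⟩, ⟨X, B, ?_⟩⟩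
      rw [← hXY, hu.2]
      simp
    · obtain ⟨s, P2, hs, hms⟩ := maxext (p := p) (q := β c') (P0 := x ++ W') (g := g) (e := e)
        (P1 := g2 ++ v ++ y) (Q0 := A') (f := f) (Q1 := B) hpn (hnd c')
        (by
          rw [hpe]
          have : x ++ w ++ (g1 ++ e :: g2) ++ v ++ y = x ++ (w ++ g1) ++ e :: g2 ++ v ++ y := by
            simp
          rw [this, hW]; simp)
        (by rw [hAB]; simp) hfg
      have main : ∀ t, g2 = s ++ t → False := by
        intro t ht
        refine hno c' _ hms ⟨⟨x, g1, t ++ v ++ y, ?_⟩, ⟨x ++ w ++ g1, t, y, ?_⟩⟩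
        · rw [hpe, ht]; simp
        · rw [hpe, ht]; simp
      have hs' : g2 ++ (v ++ y) = s ++ P2 := by simpa using hs
      rcases List.append_eq_append_iff.1 hs' with ⟨t, ht, ht'⟩ | ⟨t, ht, ht'⟩
      · cases t with
        | nil => exact main [] (by simpa using ht.symm)
        | cons t0 t =>
          obtain ⟨v0, v', rfl⟩ := List.exists_cons_of_ne_nil hv.1
          have : v0 = t0 := by simp at ht'; exact ht'.1
          subst this
          obtain ⟨Z, h, hZ⟩ := exists_last (l := e :: g2) (by simp)
          have hi : [h, v0] <:+: e :: s := by
            refine ⟨Z, t, ?_⟩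
            rw [ht, ← List.cons_append, hZ]; simp
          have hdc : d = c' := hcd d c' v0 (hv.2.2.1.subset (by simp))
            ((infix_trans hi hms.2.2.1).subset (by simp))
          subst hdc
          exact noshared hpn (hnd _) hv (infix_trans hi hms.2.1) (infix_trans hi hms.2.2.1)
      · exact main t ht

theorem not_both_orders {G : MultiDigraph} (hac : G.Acyclic) {p q s t : List G.E}
    (hp : ch G p) (hq : ch G q) (hs : s ≠ []) (ht : t ≠ [])
    (h1 : OrderedOn p s t) (h2 : OrderedOn q t s) : False := by
  obtain ⟨a, b, c, hp'⟩ := h1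
  obtain ⟨a', b', c', hq'⟩ := h2
  obtain ⟨e, s', hse⟩ := List.exists_cons_of_ne_nil hs
  let o := G.src e
  have e1 : TransGen (adj G) (hd G o s) (tl G o s) :=
    walk (ch_infix hp ⟨a, b ++ t ++ c, by simp [hp']⟩) hs (fun e _ => ⟨e, rfl, rfl⟩)
  have e2 : ReflTransGen (adj G) (tl G o s) (hd G o t) :=
    walkR (l := b) (ch_infix hp ⟨a, c, by simp [hp']⟩) hs ht (fun e _ => ⟨e, rfl, rfl⟩)
  have e3 : TransGen (adj G) (hd G o t) (tl G o t) :=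
    walk (ch_infix hp ⟨a ++ s ++ b, c, by simp [hp']⟩) ht (fun e _ => ⟨e, rfl, rfl⟩)
  have e4 : ReflTransGen (adj G) (tl G o t) (hd G o s) :=
    walkR (l := b') (ch_infix hq ⟨a', c', by simp [hq']⟩) ht hs (fun e _ => ⟨e, rfl, rfl⟩)
  exact ac_trans hac _ (((e1.trans_left e2).trans e3).trans_left e4)

theorem gap_ne {G : MultiDigraph} (hac : G.Acyclic) {p q s t a g b : List G.E}
    (hp : ch G p) (hq : ch G q) (hs : s ≠ []) (ht : MergedSub p q t)
    (h1 : p = a ++ s ++ g ++ t ++ b) (h2 : OrderedOn q s t) : g ≠ [] := by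
  rintro rfl
  obtain ⟨a', g', b', h2⟩ := h2
  obtain ⟨s', h, rfl⟩ := exists_last hs
  obtain ⟨t0, t', rfl⟩ := List.exists_cons_of_ne_nil ht.1
  let o := G.src h
  have e1 : tl G o (s' ++ [h]) = hd G o (t0 :: t') :=
    ch_append (ch_infix hp ⟨a, b, by simp [h1]⟩) (by simp) (by simp)
  have hg' : g' = [] := by
    by_contra hne
    have := walkT (o := o) (r := adj G) (w := s' ++ [h]) (l := g') (v := t0 :: t')
      (ch_infix hq ⟨a', b', by simp [h2]⟩) (by simp) (by simp) hne (fun e _ => ⟨e, rfl, rfl⟩)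
    rw [e1] at this
    exact ac_trans hac _ this
  subst hg'
  exact noshared (h := h) (ac_nodup hac hp) (ac_nodup hac hq) ht
    ⟨a ++ s', t' ++ b, by simp [h1]⟩ ⟨a' ++ s', t' ++ b', by simp [h2]⟩

variable {G : MultiDigraph} {m n : ℕ}

/-- States of the alternating procedure and their transitions. -/
def T (φ : Fin m → List G.E) (ψ : Fin n → List G.E) :
    Bool × Visit G m n → Bool × Visit G m n → Prop := fun s u =>
  MS φ ψ s.2 ∧ MS φ ψ u.2 ∧
  ((s.1 = true ∧ u.1 = false ∧ StepAgainst ψ (MS φ ψ) s.2 u.2) ∨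
   (s.1 = false ∧ u.1 = true ∧ StepAlong φ (MS φ ψ) s.2 u.2))

theorem T_inj (hac : G.Acyclic) {S1 S2 R1 R2 : G.V} {φ : Fin m → List G.E}
    {ψ : Fin n → List G.E} (hφ : G.MengerSystem S1 R1 m φ) (hψ : G.MengerSystem S2 R2 n ψ)
    {s s' u : Bool × Visit G m n} (h : T φ ψ s u) (h' : T φ ψ s' u) : s = s' := by
  have hφn : ∀ i, (φ i).Nodup := fun i => ac_nodup hac (hφ.1 i).2.1
  have hψn : ∀ i, (ψ i).Nodup := fun i => ac_nodup hac (hψ.1 i).2.1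
  obtain ⟨d, a, b, x⟩ := s
  obtain ⟨d', a', b', x'⟩ := s'
  obtain ⟨d'', a'', b'', x''⟩ := u
  obtain ⟨hs, hu, h⟩ := h
  obtain ⟨hs', -, h'⟩ := h'
  simp only [MS] at hs hs'
  rcases h with ⟨rfl, h2, h3⟩ | ⟨rfl, h2, h3⟩ <;> rcases h' with ⟨rfl, h2', h3'⟩ | ⟨rfl, h2', h3'⟩
  · obtain ⟨e1, -, e2, e3⟩ := h3
    obtain ⟨e1', -, e2', e3'⟩ := h3'
    simp only at e1 e1' e2 e2' e3 e3'
    subst e1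
    subst e1'
    rcases tri hφ.2 hφn (hψn _) (MergedSub.symm' hs) (MergedSub.symm' hs') with h | h | h
    · obtain ⟨rfl, rfl⟩ := h; rfl
    · exact (e3' (a, b'', x) hs rfl ⟨e2, h⟩).elim
    · exact absurd e2 (fun _ => e3 (a', b'', x') hs' rfl ⟨e2', h⟩)
  · simp at h2 h2'; rw [h2] at h2'; simp at h2'
  · simp at h2 h2'; rw [h2] at h2'; simp at h2'
  · obtain ⟨e1, -, e2, e3⟩ := h3
    obtain ⟨e1', -, e2', e3'⟩ := h3'
    simp only at e1 e1' e2 e2' e3 e3'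
    subst e1
    subst e1'
    rcases tri hψ.2 hψn (hφn _) hs hs' with h | h | h
    · obtain ⟨rfl, rfl⟩ := h; rfl
    · exact absurd e2 (fun _ => e3 (a'', b', x') hs' rfl ⟨h, e2'⟩)
    · exact absurd e2 (fun _ => e3' (a'', b, x) hs rfl ⟨h, e2⟩)

theorem no_loop {α : Type} {r : α → α → Prop} (hinj : ∀ s s' u, r s u → r s' u → s = s')
    {i : α} (hi : ∀ s, ¬ r s i) {s : α} (h : ReflTransGen r i s) : ¬ TransGen r s s := by
  induction h with
  | refl =>
    intro h
    obtain ⟨t, -, ht⟩ := TransGen.tail'_iff.1 h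
    exact hi t ht
  | tail _ hbc ih =>
    intro h
    obtain ⟨t, ht, ht'⟩ := TransGen.tail'_iff.1 h
    have := hinj _ _ _ hbc ht'
    subst this
    exact ih (TransGen.head' hbc ht)

/-- The vertex at which the procedure sits. -/
def pt (o : G.V) (s : Bool × Visit G m n) : G.V :=
  if s.1 then hd G o s.2.2.2 else tl G o s.2.2.2

/-- common residual steps -/
def r0 (φ : Fin m → List G.E) (ψ : Fin n → List G.E) (u v : G.V) : Prop :=
  ∃ e, ((∃ i, e ∈ φ i) ∧ (¬ ∃ j, e ∈ ψ j) ∧ G.src e = u ∧ G.dst e = v) ∨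
    ((¬ ∃ i, e ∈ φ i) ∧ (∃ j, e ∈ ψ j) ∧ G.dst e = u ∧ G.src e = v)

theorem T_walk (hac : G.Acyclic) {S1 S2 R1 R2 : G.V} {φ : Fin m → List G.E}
    {ψ : Fin n → List G.E} (hφ : G.MengerSystem S1 R1 m φ) (hψ : G.MengerSystem S2 R2 n ψ)
    (o : G.V) {s u : Bool × Visit G m n} (h : T φ ψ s u) :
    ReflTransGen (r0 φ ψ) (pt o s) (pt o u) := by
  obtain ⟨d, a, b, x⟩ := s
  obtain ⟨d', a', b', x'⟩ := u
  obtain ⟨hs, hu, h⟩ := h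
  simp only [MS] at hs hu
  rcases h with ⟨rfl, h2, h3⟩ | ⟨rfl, h2, h3⟩
  · obtain ⟨e1, -, e2, e3⟩ := h3
    simp only at e1 e2 e3 h2
    subst e1
    subst h2
    obtain ⟨A, g, B, hg⟩ := e2
    have hfree := gap_free hac hφ (hψ.1 b').2.1 (MergedSub.symm' hu) (MergedSub.symm' hs) hg
      (fun c' s hm => e3 (c', b', s) (MergedSub.symm' hm) rfl)
    have := walkR (o := o) (r := Function.swap (r0 φ ψ)) (w := x') (l := g) (v := x)
      (ch_infix (hψ.1 b').2.1 ⟨A, B, by simp [hg]⟩) hu.1 hs.1 (by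
        intro e he
        refine ⟨e, Or.inr ⟨?_, ⟨b', by rw [hg]; simp [he]⟩, rfl, rfl⟩⟩
        rintro ⟨i, hi⟩
        exact hfree e he i hi)
    exact reflTransGen_swap.1 this
  · obtain ⟨e1, -, e2, e3⟩ := h3
    simp only at e1 e2 e3 h2
    subst e1
    subst h2
    obtain ⟨A, g, B, hg⟩ := e2
    have hfree := gap_free hac hψ (hφ.1 a').2.1 hs hu hg
      (fun c' s hm => e3 (a', c', s) hm rfl)
    exact walkR (o := o) (r := r0 φ ψ) (w := x) (l := g) (v := x')
      (ch_infix (hφ.1 a').2.1 ⟨A, B, by simp [hg]⟩) hs.1 hu.1 (by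
        intro e he
        refine ⟨e, Or.inl ⟨⟨a', by rw [hg]; simp [he]⟩, ?_, rfl, rfl⟩⟩
        rintro ⟨i, hi⟩
        exact hfree e he i hi)

theorem key {S1 S2 R1 R2 : G.V} {φ : Fin m → List G.E} {ψ : Fin n → List G.E}
    (hG : MNGraph G S1 S2 R1 R2 m n φ ψ) {i s u : Bool × Visit G m n}
    (hi : ∀ s, ¬ T φ ψ s i) (his : ReflTransGen (T φ ψ) i s) (hsu : TransGen (T φ ψ) s u) :
    s.2.1 ≠ u.2.1 ∨ s.2.2.1 ≠ u.2.2.1 := by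
  obtain ⟨hac, -, -, -, hφ, hψ, -, hNφ, hNψ⟩ := hG
  have hφn : ∀ i, (φ i).Nodup := fun i => ac_nodup hac (hφ.1 i).2.1
  have hψn : ∀ i, (ψ i).Nodup := fun i => ac_nodup hac (hψ.1 i).2.1
  by_contra hcon
  push Not at hcon
  have hloop := no_loop (r := T φ ψ) (fun s s' u h h' => T_inj hac hφ hψ h h') hi his
  let o := S1
  have hW : ReflTransGen (r0 φ ψ) (pt o s) (pt o u) := by
    have := hsu.to_reflTransGen
    clear hsu hcon
    induction this with
    | refl => exact ReflTransGen.refl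
    | tail _ h ih => exact ih.trans (T_walk hac hφ hψ o h)
  have hms : MS φ ψ s.2 := by
    obtain ⟨t, ht, -⟩ := TransGen.head'_iff.1 hsu
    exact ht.1
  have hmu : MS φ ψ u.2 := by
    obtain ⟨t, -, ht⟩ := TransGen.tail'_iff.1 hsu
    exact ht.2.1
  let q1 := res G {e | ∃ i, e ∈ φ i}
  let q2 := Function.swap (res G {e | ∃ j, e ∈ ψ j})
  have ac1 : ∀ v, ¬ TransGen q1 v v := res_acyclic hac hφ hNφ
  have ac2 : ∀ v, ¬ TransGen q2 v v := fun v h => res_acyclic hac hψ hNψ v (transGen_swap.1 h)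
  have hW1 : ReflTransGen q1 (pt o s) (pt o u) := by
    refine ReflTransGen.mono ?_ _ _ hW
    rintro a b ⟨e, ⟨h1, h2, h3, h4⟩ | ⟨h1, h2, h3, h4⟩⟩
    · exact ⟨e, Or.inl ⟨h1, h3, h4⟩⟩
    · exact ⟨e, Or.inr ⟨h1, h3, h4⟩⟩
  have hW2 : ReflTransGen q2 (pt o s) (pt o u) := by
    refine ReflTransGen.mono ?_ _ _ hW
    rintro a b ⟨e, ⟨h1, h2, h3, h4⟩ | ⟨h1, h2, h3, h4⟩⟩
    · exact ⟨e, Or.inr ⟨h2, h4, h3⟩⟩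
    · exact ⟨e, Or.inl ⟨h2, h4, h3⟩⟩
  have no1 : ¬ TransGen q1 (pt o u) (pt o s) := fun h => ac1 _ (h.trans_left hW1)
  have no2 : ¬ TransGen q2 (pt o u) (pt o s) := fun h => ac2 _ (h.trans_left hW2)
  obtain ⟨d, a, b, x⟩ := s
  obtain ⟨d', a', b', y⟩ := u
  simp only at hcon
  obtain ⟨rfl, rfl⟩ := hcon
  simp only [MS] at hms hmu
  have hcφ : ch G (φ a) := (hφ.1 a).2.1
  have hcψ : ch G (ψ b) := (hψ.1 b).2.1
  have f1 : ∀ e ∈ φ a, q1 (G.src e) (G.dst e) := fun e he => ⟨e, Or.inl ⟨⟨a, he⟩, rfl, rfl⟩⟩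
  have f2 : ∀ e ∈ ψ b, Function.swap q2 (G.src e) (G.dst e) :=
    fun e he => ⟨e, Or.inl ⟨⟨b, he⟩, rfl, rfl⟩⟩
  have in1 : ∀ z, MergedSub (φ a) (ψ b) z → TransGen q1 (hd G o z) (tl G o z) := fun z hz =>
    walk (ch_infix hcφ hz.2.1) hz.1 (fun e he => f1 e (hz.2.1.subset he))
  have in2 : ∀ z, MergedSub (φ a) (ψ b) z → TransGen q2 (tl G o z) (hd G o z) := fun z hz =>
    transGen_swap.1 (walk (ch_infix hcψ hz.2.2.1) hz.1 (fun e he => f2 e (hz.2.2.1.subset he)))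
  have ord : ∀ z t, MergedSub (φ a) (ψ b) z → MergedSub (φ a) (ψ b) t → OrderedOn (φ a) z t →
      OrderedOn (ψ b) z t := by
    intro z t hz ht h
    rcases tri hφ.2 hφn (hψn b) (MergedSub.symm' hz) (MergedSub.symm' ht) with h' | h' | h'
    · rw [h'.1] at h
      exact absurd h (orderedOn_irrefl (hφn a) ht.1)
    · exact h'
    · exact (not_both_orders hac hcφ hcψ hz.1 ht.1 h h').elim
  rcases tri hψ.2 hψn (hφn a) hms hmu with h | h | h
  · obtain ⟨rfl, -⟩ := h
    cases d <;> cases d'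
    · exact hloop hsu
    · exact no1 (in1 x hms)
    · exact no2 (in2 x hms)
    · exact hloop hsu
  · have h' := ord x y hms hmu h
    obtain ⟨A, g, B, hg⟩ := h'
    have hgne : g ≠ [] := gap_ne hac hcψ hcφ hms.1 (MergedSub.symm' hmu) hg h
    have mid : TransGen q2 (hd G o y) (tl G o x) :=
      transGen_swap.1 (walkT (w := x) (l := g) (v := y)
        (ch_infix hcψ ⟨A, B, by simp [hg]⟩) hms.1 hmu.1 hgne
        (fun e he => f2 e (by rw [hg]; simp [he])))
    refine no2 ?_
    cases d <;> cases d'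
    · exact (in2 y hmu).trans mid
    · exact mid
    · exact ((in2 y hmu).trans mid).trans (in2 x hms)
    · exact mid.trans (in2 x hms)
  · have h' := ord y x hmu hms h
    obtain ⟨A, g, B, hg⟩ := h
    have hgne : g ≠ [] := gap_ne hac hcφ hcψ hmu.1 hms hg h'
    have mid : TransGen q1 (tl G o y) (hd G o x) :=
      walkT (w := y) (l := g) (v := x)
        (ch_infix hcφ ⟨A, B, by simp [hg]⟩) hmu.1 hms.1 hgne
        (fun e he => f1 e (by rw [hg]; simp [he]))
    refine no1 ?_
    cases d <;> cases d'
    · exact mid.trans (in1 x hms)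
    · exact ((in1 y hmu).trans mid).trans (in1 x hms)
    · exact mid
    · exact (in1 y hmu).trans mid

theorem chain_reach {φ : Fin m → List G.E} {ψ : Fin n → List G.E} {d : Bool} {v : Visit G m n}
    {L : List (Visit G m n)} (h : AAChain φ ψ (MS φ ψ) d v L) (hv : MS φ ψ v) :
    ∀ w ∈ L, ∃ d', TransGen (T φ ψ) (d, v) (d', w) := by
  induction h with
  | stopAgainst v _ => simp
  | stopAlong v _ => simp
  | consAgainst v w rest hs _ ih =>
    have ht : T φ ψ (true, v) (false, w) := ⟨hv, hs.2.1, Or.inl ⟨rfl, rfl, hs⟩⟩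
    intro u hu
    rcases List.mem_cons.1 hu with rfl | hu
    · exact ⟨_, TransGen.single ht⟩
    · obtain ⟨d', hd'⟩ := ih hs.2.1 u hu
      exact ⟨d', TransGen.head ht hd'⟩
  | consAlong v w rest hs _ ih =>
    have ht : T φ ψ (false, v) (true, w) := ⟨hv, hs.2.1, Or.inr ⟨rfl, rfl, hs⟩⟩
    intro u hu
    rcases List.mem_cons.1 hu with rfl | hu
    · exact ⟨_, TransGen.single ht⟩
    · obtain ⟨d', hd'⟩ := ih hs.2.1 u hu
      exact ⟨d', TransGen.head ht hd'⟩

theorem chain_pairwise {S1 S2 R1 R2 : G.V} {φ : Fin m → List G.E} {ψ : Fin n → List G.E}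
    (hG : MNGraph G S1 S2 R1 R2 m n φ ψ) {i : Bool × Visit G m n}
    (hi : ∀ s, ¬ T φ ψ s i) {d : Bool} {v : Visit G m n}
    {L : List (Visit G m n)} (h : AAChain φ ψ (MS φ ψ) d v L) (hv : MS φ ψ v)
    (hiv : ReflTransGen (T φ ψ) i (d, v)) :
    (v :: L).Pairwise fun v w => v.1 ≠ w.1 ∨ v.2.1 ≠ w.2.1 := by
  induction h with
  | stopAgainst v _ => simp
  | stopAlong v _ => simp
  | consAgainst v w rest hs hc ih =>
    have ht : T φ ψ (true, v) (false, w) := ⟨hv, hs.2.1, Or.inl ⟨rfl, rfl, hs⟩⟩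
    refine List.pairwise_cons.2 ⟨?_, ih hs.2.1 (hiv.tail ht)⟩
    intro u hu
    obtain ⟨d', h'⟩ := chain_reach (AAChain.consAgainst v w rest hs hc) hv u hu
    exact key hG hi hiv h'
  | consAlong v w rest hs hc ih =>
    have ht : T φ ψ (false, v) (true, w) := ⟨hv, hs.2.1, Or.inr ⟨rfl, rfl, hs⟩⟩
    refine List.pairwise_cons.2 ⟨?_, ih hs.2.1 (hiv.tail ht)⟩
    intro u hu
    obtain ⟨d', h'⟩ := chain_reach (AAChain.consAlong v w rest hs hc) hv u hu
    exact key hG hi hiv h'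

end main

end PPair


/-- In a non-reroutable `(m, n)`-graph `G` with distinct sources, any
path pair `(φ_a, ψ_b)` occurs at most once in any given AA-sequence: no AA-sequence
visits two distinct merged subpaths associated with the same pair. -/
theorem path_pair_occurs_at_most_once
    (G : MultiDigraph) (S1 S2 R1 R2 : G.V) (m n : ℕ)
    (φ : Fin m → List G.E) (ψ : Fin n → List G.E)
    (hG : MNGraph G S1 S2 R1 R2 m n φ ψ) (hS : S1 ≠ S2) :
    (∀ (i : Fin m) (L : List (Visit G m n)), IsPhiAA φ ψ (MS φ ψ) i L →
        L.Pairwise fun v w => v.1 ≠ w.1 ∨ v.2.1 ≠ w.2.1) ∧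
      ∀ (j : Fin n) (L : List (Visit G m n)), IsPsiAA φ ψ (MS φ ψ) j L →
        L.Pairwise fun v w => v.1 ≠ w.1 ∨ v.2.1 ≠ w.2.1 := by
  open PPair in
  refine ⟨?_, ?_⟩
  · rintro i L (⟨rfl, -⟩ | ⟨v, rest, rfl, hvi, hv, hfirst, hc⟩)
    · exact List.Pairwise.nil
    · refine chain_pairwise hG (i := (true, v)) ?_ hc hv Relation.ReflTransGen.refl
      rintro ⟨d, s⟩ ⟨hs, -, ⟨-, h, -⟩ | ⟨-, -, h⟩⟩
      · simp at h
      · obtain ⟨e1, -, e2, -⟩ := h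
        simp only at e1 e2
        have : s.1 = i := e1.symm.trans hvi
        exact hfirst s hs this (this ▸ e2)
  · rintro j L (⟨rfl, -⟩ | ⟨v, rest, rfl, hvi, hv, hfirst, hc⟩)
    · exact List.Pairwise.nil
    · refine chain_pairwise hG (i := (false, v)) ?_ hc hv Relation.ReflTransGen.refl
      rintro ⟨d, s⟩ ⟨hs, -, ⟨-, -, h⟩ | ⟨-, h, -⟩⟩
      · obtain ⟨e1, -, e2, -⟩ := h
        simp only at e1 e2
        have : s.2.1 = j := e1.symm.trans hvi
        exact hfirst s hs this (this ▸ e2)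
      · simp at h
end
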